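/- arXiv:1810.08397 — 4 statements merged into one kernel-verified Lean document; each statement's English description precedes it below -/
import Mathlib

section
/- Let (Ω, μ) be a finite measure space and p : Ω → ℝ measurable with 1 < p⁻ ≤ p(x) ≤ p⁺ < ∞ for all x ∈ Ω. Let u and (u_k)_{k∈ℕ} be measurable real-valued functions on Ω with ρ(u) < ∞ and ρ(u_k) < ∞ for all k. Then lim_{k→∞} ρ(u_k − u) = 0 if and only if u_k → u in measure μ on Ω and lim_{k→∞} ρ(u_k) = ρ(u). -/
open MeasureTheory

/-- The modular `ρ(u) = ∫_Ω |u(x)|^{p(x)} dμ` of a variable exponent Lebesgue space. -/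
noncomputable def modular {Ω : Type*} [MeasurableSpace Ω] (μ : Measure Ω)
    (p : Ω → ℝ) (u : Ω → ℝ) : ℝ :=
  ∫ x, |u x| ^ p x ∂μ

/-- The Luxemburg norm `|u|_{p(·)} = inf {λ > 0 : ρ(u/λ) ≤ 1}`. -/
noncomputable def luxNorm {Ω : Type*} [MeasurableSpace Ω] (μ : Measure Ω)
    (p : Ω → ℝ) (u : Ω → ℝ) : ℝ :=
  sInf {l : ℝ | 0 < l ∧ modular μ p (fun x => u x / l) ≤ 1}


open Filter

/-- **Pratt's lemma** for a nonnegative sequence tending to zero almost everywhere. -/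
theorem tendsto_integral_zero_of_le_of_tendsto_integral {Ω : Type*} [MeasurableSpace Ω]
    {μ : Measure Ω} {f g : ℕ → Ω → ℝ} {h : Ω → ℝ}
    (hf : ∀ n, Integrable (f n) μ) (hg : ∀ n, Integrable (g n) μ) (hh : Integrable h μ)
    (hf_nonneg : ∀ n x, 0 ≤ f n x) (hfg : ∀ n x, f n x ≤ g n x)
    (hf_lim : ∀ᵐ x ∂μ, Tendsto (fun n => f n x) atTop (nhds 0))
    (hg_lim : ∀ᵐ x ∂μ, Tendsto (fun n => g n x) atTop (nhds (h x)))
    (hg_int : Tendsto (fun n => ∫ x, g n x ∂μ) atTop (nhds (∫ x, h x ∂μ))) :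
    Tendsto (fun n => ∫ x, f n x ∂μ) atTop (nhds 0) := by
  have h_nonneg : ∀ᵐ x ∂μ, 0 ≤ h x := by
    filter_upwards [hg_lim] with x hx
    exact ge_of_tendsto' hx fun n => (hf_nonneg n x).trans (hfg n x)
  have hmin : ∀ n, Integrable (fun x => min (f n x) (h x)) μ := fun n => (hf n).inf hh
  have hpos : ∀ n, Integrable (fun x => max (h x - g n x) 0) μ :=
    fun n => (hh.sub (hg n)).pos_part
  have hdiff : ∀ n, Integrable (fun x => g n x - h x) μ := fun n => (hg n).sub hh
  have hsum : ∀ n, Integrable (fun x => min (f n x) (h x) + (g n x - h x)) μ :=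
    fun n => (hmin n).add (hdiff n)
  have hmin_lim : Tendsto (fun n => ∫ x, min (f n x) (h x) ∂μ) atTop (nhds 0) := by
    have := tendsto_integral_of_dominated_convergence (μ := μ)
      (F := fun n x => min (f n x) (h x)) (f := fun _ => 0) h
      (fun n => (hmin n).aestronglyMeasurable) hh
      (fun n => by
        filter_upwards [h_nonneg] with x hx
        rw [Real.norm_of_nonneg (le_min (hf_nonneg n x) hx)]
        exact min_le_right _ _)
      (by
        filter_upwards [h_nonneg, hf_lim] with x hx hfx
        simpa [hx] using hfx.min (tendsto_const_nhds (x := h x)))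
    simpa using this
  have hpos_lim : Tendsto (fun n => ∫ x, max (h x - g n x) 0 ∂μ) atTop (nhds 0) := by
    have := tendsto_integral_of_dominated_convergence (μ := μ)
      (F := fun n x => max (h x - g n x) 0) (f := fun _ => 0) h
      (fun n => (hpos n).aestronglyMeasurable) hh
      (fun n => by
        filter_upwards [h_nonneg] with x hx
        rw [Real.norm_of_nonneg (le_max_right _ _)]
        exact max_le (by linarith [hf_nonneg n x, hfg n x]) hx)
      (by
        filter_upwards [hg_lim] with x hgx
        simpa using (hgx.const_sub (h x)).max (tendsto_const_nhds (x := (0 : ℝ))))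
    simpa using this
  have hbound : Tendsto (fun n => (∫ x, min (f n x) (h x) ∂μ) +
      ((∫ x, g n x ∂μ) - ∫ x, h x ∂μ) + ∫ x, max (h x - g n x) 0 ∂μ) atTop (nhds 0) := by
    simpa using (hmin_lim.add (hg_int.sub_const (∫ x, h x ∂μ))).add hpos_lim
  refine squeeze_zero (fun n => integral_nonneg (hf_nonneg n)) (fun n => ?_) hbound
  rw [← integral_sub (hg n) hh, ← integral_add (hmin n) (hdiff n),
    ← integral_add (hsum n) (hpos n)]
  refine integral_mono (hf n) ((hsum n).add (hpos n)) fun x => ?_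
  have hle := hfg n x
  show f n x ≤ min (f n x) (h x) + (g n x - h x) + max (h x - g n x) 0
  rcases min_cases (f n x) (h x) with ⟨h₁, h₂⟩ | ⟨h₁, h₂⟩ <;>
    rcases max_cases (h x - g n x) 0 with ⟨h₃, h₄⟩ | ⟨h₃, h₄⟩ <;> linarith

/-- Pratt's lemma for superpositions `φ x (v n x)` of a sequence converging in measure. -/
theorem tendsto_integral_zero_of_tendstoInMeasure_of_le {Ω : Type*} [MeasurableSpace Ω]
    {μ : Measure Ω} {v : ℕ → Ω → ℝ} {u : Ω → ℝ} (hv : TendstoInMeasure μ v atTop u)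
    {φ γ : Ω → ℝ → ℝ}
    (hφ : ∀ n, Integrable (fun x => φ x (v n x)) μ)
    (hγ : ∀ n, Integrable (fun x => γ x (v n x)) μ) (hγu : Integrable (fun x => γ x (u x)) μ)
    (hφ_nonneg : ∀ x t, 0 ≤ φ x t) (hφγ : ∀ x t, φ x t ≤ γ x t)
    (hφ_cont : ∀ x, Continuous (φ x)) (hγ_cont : ∀ x, Continuous (γ x))
    (hφu : ∀ x, φ x (u x) = 0)
    (hγ_int : Tendsto (fun n => ∫ x, γ x (v n x) ∂μ) atTop (nhds (∫ x, γ x (u x) ∂μ))) :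
    Tendsto (fun n => ∫ x, φ x (v n x) ∂μ) atTop (nhds 0) := by
  refine tendsto_of_subseq_tendsto fun ns hns => ?_
  obtain ⟨ms, hms, hlim⟩ := (hv.comp hns).exists_seq_tendsto_ae
  refine ⟨ms, tendsto_integral_zero_of_le_of_tendsto_integral
    (f := fun n x => φ x (v (ns (ms n)) x)) (g := fun n x => γ x (v (ns (ms n)) x))
    (fun n => hφ _) (fun n => hγ _) hγu (fun n x => hφ_nonneg _ _) (fun n x => hφγ _ _)
    ?_ ?_ (hγ_int.comp (hns.comp hms.tendsto_atTop))⟩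
  · filter_upwards [hlim] with x hx
    rw [← hφu x]
    exact ((hφ_cont x).tendsto _).comp hx
  · filter_upwards [hlim] with x hx
    exact ((hγ_cont x).tendsto _).comp hx

theorem abs_add_rpow_le_two_rpow_mul {a b p P : ℝ} (hp : 1 ≤ p) (hpP : p ≤ P) :
    |a + b| ^ p ≤ 2 ^ P * (|a| ^ p + |b| ^ p) := by
  have hadd : (|a| + |b|) ^ p ≤ 2 ^ (p - 1) * (|a| ^ p + |b| ^ p) := by
    exact_mod_cast NNReal.rpow_add_le_mul_rpow_add_rpow ⟨|a|, abs_nonneg a⟩ ⟨|b|, abs_nonneg b⟩ hp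
  calc |a + b| ^ p ≤ (|a| + |b|) ^ p :=
        Real.rpow_le_rpow (abs_nonneg _) (abs_add_le a b) (by linarith)
    _ ≤ 2 ^ (p - 1) * (|a| ^ p + |b| ^ p) := hadd
    _ ≤ 2 ^ P * (|a| ^ p + |b| ^ p) := by
        gcongr
        · norm_num
        · linarith

theorem abs_sub_rpow_le_two_rpow_mul {a b p P : ℝ} (hp : 1 ≤ p) (hpP : p ≤ P) :
    |a - b| ^ p ≤ 2 ^ P * (|a| ^ p + |b| ^ p) := by
  simpa [sub_eq_add_neg] using abs_add_rpow_le_two_rpow_mul (a := a) (b := -b) hp hpP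

theorem tendstoInMeasure_of_tendsto_modular_sub {Ω : Type*} [MeasurableSpace Ω]
    {μ : Measure Ω} [IsFiniteMeasure μ] {p : Ω → ℝ} {P : ℝ} (hp : ∀ x, 0 ≤ p x)
    (hpP : ∀ x, p x ≤ P) {u : Ω → ℝ} {v : ℕ → Ω → ℝ}
    (hint : ∀ k, Integrable (fun x => |v k x - u x| ^ p x) μ)
    (hlim : Tendsto (fun k => modular μ p (fun x => v k x - u x)) atTop (nhds 0)) :
    TendstoInMeasure μ v atTop u := by
  rw [tendstoInMeasure_iff_measureReal_norm]
  intro ε hε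
  set δ : ℝ := min ε 1 ^ P
  have hm : 0 < min ε 1 := lt_min hε one_pos
  have hδ_pos : 0 < δ := Real.rpow_pos_of_pos hm _
  refine squeeze_zero (fun _ => measureReal_nonneg) (fun k => ?_)
    (by simpa using hlim.div_const δ)
  rw [le_div_iff₀' hδ_pos]
  refine le_trans ?_ (mul_meas_ge_le_integral_of_nonneg
    (Eventually.of_forall fun x => Real.rpow_nonneg (abs_nonneg _) _) (hint k) δ)
  refine mul_le_mul_of_nonneg_left (measureReal_mono fun x hx => ?_) hδ_pos.le
  calc δ ≤ min ε 1 ^ p x := Real.rpow_le_rpow_of_exponent_ge hm (min_le_right _ _) (hpP x)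
    _ ≤ |v k x - u x| ^ p x := Real.rpow_le_rpow hm.le ((min_le_left _ _).trans hx) (hp x)

/-- `ρ(u_k − u) → 0` if and only if `u_k → u` in measure and `ρ(u_k) → ρ(u)`. -/
theorem tendsto_modular_iff_tendstoInMeasure {Ω : Type*} [MeasurableSpace Ω] (μ : Measure Ω)
    [IsFiniteMeasure μ] (p : Ω → ℝ) (hp : Measurable p) (pm pM : ℝ)
    (hpm : 1 < pm) (hple : ∀ x, pm ≤ p x) (hpue : ∀ x, p x ≤ pM)
    (u : Ω → ℝ) (hu : Measurable u)
    (hfin : Integrable (fun x => |u x| ^ p x) μ)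
    (uk : ℕ → Ω → ℝ) (huk : ∀ k, Measurable (uk k))
    (hfink : ∀ k, Integrable (fun x => |uk k x| ^ p x) μ) :
    Tendsto (fun k => modular μ p (fun x => uk k x - u x)) atTop (nhds 0) ↔
    (TendstoInMeasure μ uk atTop u ∧
      Tendsto (fun k => modular μ p (uk k)) atTop (nhds (modular μ p u))) := by
  have hp1 : ∀ x, 1 ≤ p x := fun x => hpm.le.trans (hple x)
  have hp_pos : ∀ x, 0 < p x := fun x => one_pos.trans_le (hp1 x)
  have hsub_le : ∀ x t, |t - u x| ^ p x ≤ 2 ^ pM * (|t| ^ p x + |u x| ^ p x) := fun x t =>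
    abs_sub_rpow_le_two_rpow_mul (hp1 x) (hpue x)
  have hsub : ∀ k, Integrable (fun x => |uk k x - u x| ^ p x) μ := fun k =>
    (((hfink k).add hfin).const_mul (2 ^ pM)).mono'
      (Measurable.aestronglyMeasurable (by have := huk k; fun_prop))
      (Eventually.of_forall fun x => by
        rw [Real.norm_of_nonneg (Real.rpow_nonneg (abs_nonneg _) _)]
        exact hsub_le x _)
  have hcont : ∀ x, Continuous fun t : ℝ => |t| ^ p x := fun x =>
    continuous_abs.rpow_const fun _ => Or.inr (hp_pos x).le
  have hcont_sub : ∀ x, Continuous fun t : ℝ => |t - u x| ^ p x := fun x =>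
    (hcont x).comp (continuous_id.sub continuous_const)
  have hzero : ∀ x, |u x - u x| ^ p x = 0 := fun x => by simp [(hp_pos x).ne']
  constructor
  · intro hlim
    have hmeas : TendstoInMeasure μ uk atTop u :=
      tendstoInMeasure_of_tendsto_modular_sub (fun x => (hp_pos x).le) hpue hsub hlim
    refine ⟨hmeas, ?_⟩
    have hdiff : Tendsto (fun k => ∫ x, |(|uk k x| ^ p x - |u x| ^ p x)| ∂μ) atTop (nhds 0) := by
      refine tendsto_integral_zero_of_tendstoInMeasure_of_le hmeas
        (φ := fun x t => |(|t| ^ p x - |u x| ^ p x)|)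
        (γ := fun x t => 2 ^ pM * |t - u x| ^ p x + (2 ^ pM + 1) * |u x| ^ p x)
        (fun k => ((hfink k).sub hfin).abs)
        (fun k => ((hsub k).const_mul _).add (hfin.const_mul _))
        (by simpa only [hzero, mul_zero, zero_add] using hfin.const_mul (2 ^ pM + 1)) (fun x t => abs_nonneg _)
        (fun x t => ?_) (fun x => ((hcont x).sub continuous_const).abs)
        (fun x => (continuous_const.mul (hcont_sub x)).add continuous_const)
        (fun x => by simp) ?_
      · have hle : |t| ^ p x ≤ 2 ^ pM * (|t - u x| ^ p x + |u x| ^ p x) := by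
          simpa using abs_add_rpow_le_two_rpow_mul (a := t - u x) (b := u x) (hp1 x) (hpue x)
        have ht : 0 ≤ |t| ^ p x := by positivity
        have hux : 0 ≤ |u x| ^ p x := by positivity
        exact abs_le.2 ⟨by linarith, by linarith⟩
      · have hint : ∀ k, ∫ x, (2 ^ pM * |uk k x - u x| ^ p x + (2 ^ pM + 1) * |u x| ^ p x) ∂μ =
            2 ^ pM * modular μ p (fun x => uk k x - u x) + ∫ x, (2 ^ pM + 1) * |u x| ^ p x ∂μ :=
          fun k => by
            rw [integral_add ((hsub k).const_mul _) (hfin.const_mul _), integral_const_mul, modular]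
        simp only [hint, hzero, mul_zero, zero_add]
        simpa using (hlim.const_mul (2 ^ pM)).add_const (∫ x, (2 ^ pM + 1) * |u x| ^ p x ∂μ)
    rw [tendsto_iff_norm_sub_tendsto_zero]
    refine squeeze_zero (fun _ => norm_nonneg _) (fun k => ?_) hdiff
    rw [modular, modular, ← integral_sub (hfink k) hfin]
    exact norm_integral_le_integral_norm _
  · rintro ⟨hmeas, hlim⟩
    refine tendsto_integral_zero_of_tendstoInMeasure_of_le hmeas
      (φ := fun x t => |t - u x| ^ p x) (γ := fun x t => 2 ^ pM * (|t| ^ p x + |u x| ^ p x))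
      hsub (fun k => ((hfink k).add hfin).const_mul _) ((hfin.add hfin).const_mul _)
      (fun x t => by positivity) hsub_le hcont_sub
      (fun x => continuous_const.mul ((hcont x).add continuous_const)) hzero ?_
    have hint : ∀ w : Ω → ℝ, Integrable (fun x => |w x| ^ p x) μ →
        ∫ x, 2 ^ pM * (|w x| ^ p x + |u x| ^ p x) ∂μ =
          2 ^ pM * (modular μ p w + modular μ p u) := fun w hw => by
      rw [integral_const_mul, integral_add hw hfin, modular, modular]
    simp only [hint _ (hfink _), hint u hfin]
    exact (hlim.add_const _).const_mul _
end

section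
/- Let V ⊂ ℝ^N be a bounded open set that is symmetric (V = −V) and contains 0, and let ∂V denote its topological boundary. Then the Krasnoselskii genus of ∂V equals N; that is: (a) there exists a continuous odd map from ∂V to ℝ^N \ {0} (indeed the identity map, since 0 ∉ ∂V), and (b) for every m < N there is no continuous odd map from ∂V to ℝ^m \ {0}. -/
namespace CubicalCochain

open Finset

variable {ι : Type*} [DecidableEq ι]

/-- The coboundary, modulo `2`, of a cubical cochain on the lattice `ι → ℕ`; the value
`φ x S` is attached to the cube with lowest vertex `x` and edge directions `S`. -/
def coboundary (φ : (ι → ℕ) → Finset ι → ZMod 2) (x : ι → ℕ) (S : Finset ι) : ZMod 2 :=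
  ∑ i ∈ S, (φ (x + Pi.single i 1) (S.erase i) + φ x (S.erase i))

/-- The cup product of the coboundaries of a list of `0`-cochains. -/
def cupCoboundary : List ((ι → ℕ) → ZMod 2) → (ι → ℕ) → Finset ι → ZMod 2
  | [], _, _ => 1
  | a :: L, x, S =>
      ∑ i ∈ S, (a (x + Pi.single i 1) + a x) * cupCoboundary L (x + Pi.single i 1) (S.erase i)

/-- The vertices of the cube with lowest vertex `x` and edge directions `S`. -/
def cube (x : ι → ℕ) (S : Finset ι) : Set (ι → ℕ) :=
  {y | ∀ k, x k ≤ y k ∧ y k ≤ x k + if k ∈ S then 1 else 0}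

lemma self_mem_cube (x : ι → ℕ) (S : Finset ι) : x ∈ cube x S :=
  fun _ => ⟨le_rfl, Nat.le_add_right _ _⟩

lemma cube_add_single_subset (x : ι → ℕ) {S : Finset ι} {i : ι} (hi : i ∈ S) :
    cube (x + Pi.single i 1) (S.erase i) ⊆ cube x S := by
  intro y hy k
  have := hy k
  by_cases hk : k = i
  · subst hk
    simp_all
    omega
  · simp_all

lemma add_single_mem_cube (x : ι → ℕ) {S : Finset ι} {i : ι} (hi : i ∈ S) :
    x + Pi.single i 1 ∈ cube x S :=
  cube_add_single_subset x hi (self_mem_cube _ _)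

lemma sum_sum_erase_eq_zero (S : Finset ι) (g : ι → ι → ZMod 2)
    (hg : ∀ i j, i ≠ j → g i j = g j i) :
    ∑ i ∈ S, ∑ j ∈ S.erase i, g i j = 0 := by
  rw [Finset.sum_sigma']
  refine Finset.sum_involution (fun p _ => ⟨p.2, p.1⟩) ?_ ?_ ?_ ?_
  · rintro ⟨i, j⟩ h
    simp only [mem_sigma, mem_erase] at h
    simp only
    rw [hg i j (Ne.symm h.2.1)]
    exact CharTwo.add_self_eq_zero _
  · rintro ⟨i, j⟩ h _ heq
    simp only [mem_sigma, mem_erase] at h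
    simp only [Sigma.mk.injEq] at heq
    exact h.2.1 heq.1
  · rintro ⟨i, j⟩ h
    simp only [mem_sigma, mem_erase] at h ⊢
    exact ⟨h.2.2, Ne.symm h.2.1, h.1⟩
  · rintro ⟨i, j⟩ _
    rfl

lemma coboundary_coboundary (φ : (ι → ℕ) → Finset ι → ZMod 2) (x : ι → ℕ) (S : Finset ι) :
    coboundary (coboundary φ) x S = 0 := by
  have key := sum_sum_erase_eq_zero S (fun i j =>
    (φ (x + Pi.single i 1 + Pi.single j 1) ((S.erase i).erase j) +
      φ x ((S.erase i).erase j)) +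
    (φ (x + Pi.single i 1) ((S.erase i).erase j) +
      φ (x + Pi.single j 1) ((S.erase i).erase j))) (by
    intro i j _
    rw [erase_right_comm, add_right_comm x,
      add_comm (φ (x + Pi.single i 1) _)])
  rw [← key]
  simp only [coboundary]
  refine sum_congr rfl fun i _ => ?_
  rw [← sum_add_distrib]
  exact sum_congr rfl fun j _ => by ring

lemma coboundary_mul (a : (ι → ℕ) → ZMod 2) (φ : (ι → ℕ) → Finset ι → ZMod 2)
    (x : ι → ℕ) (S : Finset ι) :
    coboundary (fun y T => a y * φ y T) x S =
      ∑ i ∈ S, (a (x + Pi.single i 1) + a x) * φ (x + Pi.single i 1) (S.erase i) +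
        a x * coboundary φ x S := by
  simp only [coboundary, mul_sum]
  rw [← sum_add_distrib]
  refine sum_congr rfl fun i _ => ?_
  have := CharTwo.add_self_eq_zero (a x * φ (x + Pi.single i 1) (S.erase i))
  linear_combination -this

lemma coboundary_cupCoboundary (L : List ((ι → ℕ) → ZMod 2)) (x : ι → ℕ) (S : Finset ι) :
    coboundary (cupCoboundary L) x S = 0 := by
  induction L generalizing x S with
  | nil =>
    simp only [coboundary, cupCoboundary]
    exact sum_eq_zero fun _ _ => CharTwo.add_self_eq_zero _
  | cons a L ih =>
    have : cupCoboundary (a :: L) = coboundary (fun y T => a y * cupCoboundary L y T) := by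
      funext y T
      rw [coboundary_mul, ih, mul_zero, add_zero, cupCoboundary]
    rw [this, coboundary_coboundary]

lemma cupCoboundary_cons (a : (ι → ℕ) → ZMod 2) (L : List ((ι → ℕ) → ZMod 2))
    (x : ι → ℕ) (S : Finset ι) :
    cupCoboundary (a :: L) x S = coboundary (fun y T => a y * cupCoboundary L y T) x S := by
  rw [coboundary_mul, coboundary_cupCoboundary, mul_zero, add_zero, cupCoboundary]

lemma cupCoboundary_eq_zero_of_const {L : List ((ι → ℕ) → ZMod 2)} {x : ι → ℕ} {S : Finset ι}
    {a : (ι → ℕ) → ZMod 2} (ha : a ∈ L) {c : ZMod 2} (hc : ∀ y ∈ cube x S, a y = c) :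
    cupCoboundary L x S = 0 := by
  induction L generalizing x S with
  | nil => simp at ha
  | cons b L ih =>
    rw [cupCoboundary]
    refine sum_eq_zero fun i hi => ?_
    rcases List.mem_cons.1 ha with rfl | ha
    · rw [hc _ (add_single_mem_cube x hi), hc _ (self_mem_cube x S),
        CharTwo.add_self_eq_zero, zero_mul]
    · rw [ih ha fun y hy => hc y (cube_add_single_subset x hi hy), mul_zero]

lemma cupCoboundary_map_congr {X : Type*} {L : List X} {f g : X → (ι → ℕ) → ZMod 2}
    {x : ι → ℕ} {S : Finset ι} (h : ∀ a ∈ L, ∃ c, ∀ y ∈ cube x S, f a y = g a y + c) :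
    cupCoboundary (L.map f) x S = cupCoboundary (L.map g) x S := by
  induction L generalizing x S with
  | nil => rfl
  | cons b L ih =>
    simp only [List.map_cons, cupCoboundary]
    refine sum_congr rfl fun i hi => ?_
    rw [ih fun a ha => ?_]
    · obtain ⟨c, hc⟩ := h b List.mem_cons_self
      rw [hc _ (add_single_mem_cube x hi), hc _ (self_mem_cube x S)]
      linear_combination (cupCoboundary (L.map g) (x + Pi.single i 1) (S.erase i)) *
        CharTwo.add_self_eq_zero c
    · obtain ⟨c, hc⟩ := h a (List.mem_cons_of_mem _ ha)
      exact ⟨c, fun y hy => hc y (cube_add_single_subset x hi hy)⟩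

/-- The point of the orthant with signs `ε` with absolute coordinates `x`. -/
def orthantPoint (ε : ι → ℤ) (x : ι → ℕ) : ι → ℤ := fun i => ε i * x i

/-- The pullback of a cochain to an orthant. -/
def pull (ε : ι → ℤ) (a : (ι → ℤ) → ZMod 2) : (ι → ℕ) → ZMod 2 :=
  fun x => a (orthantPoint ε x)

lemma orthantPoint_update {ε : ι → ℤ} {x : ι → ℕ} {j : ι} (s : ℤ) (hx : x j = 0) :
    orthantPoint (Function.update ε j s) x = orthantPoint ε x := by
  ext k
  by_cases hk : k = j
  · subst hk; simp [orthantPoint, hx]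
  · simp [orthantPoint, hk]

variable [Fintype ι]

/-- Functions with values in `T` on `S` and equal to `t` off `S`. -/
def partialPi {β : Type*} (T : Finset β) (t : β) (S : Finset ι) : Finset (ι → β) :=
  Fintype.piFinset fun i => if i ∈ S then T else {t}

lemma mem_partialPi {β : Type*} {T : Finset β} {t : β} {S : Finset ι} {x : ι → β} :
    x ∈ partialPi T t S ↔ (∀ i ∈ S, x i ∈ T) ∧ ∀ i ∉ S, x i = t := by
  simp only [partialPi, Fintype.mem_piFinset]
  constructor
  · intro h
    exact ⟨fun i hi => by simpa [hi] using h i, fun i hi => by simpa [hi] using h i⟩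
  · rintro ⟨h₁, h₂⟩ i
    by_cases hi : i ∈ S
    · simpa [hi] using h₁ i hi
    · simpa [hi] using h₂ i hi

lemma sum_partialPi {β M : Type*} [AddCommMonoid M] (T : Finset β) (t : β)
    {S : Finset ι} {j : ι} (hj : j ∈ S) (h : (ι → β) → M) :
    ∑ x ∈ partialPi T t S, h x =
      ∑ x ∈ partialPi T t (S.erase j), ∑ s ∈ T, h (Function.update x j s) := by
  rw [← sum_product']
  refine sum_nbij' (fun x => (Function.update x j t, x j))
    (fun p => Function.update p.1 j p.2) ?_ ?_ ?_ ?_ ?_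
  · intro x hx
    rw [mem_partialPi] at hx
    rw [mem_product, mem_partialPi]
    refine ⟨⟨fun i hi => ?_, fun i hi => ?_⟩, hx.1 j hj⟩
    · rw [mem_erase] at hi
      simpa [hi.1] using hx.1 i hi.2
    · by_cases hij : i = j
      · simp [hij]
      · simpa [hij] using hx.2 i (by simpa [hij] using hi)
  · rintro ⟨x, s⟩ hx
    rw [mem_product, mem_partialPi] at hx
    rw [mem_partialPi]
    refine ⟨fun i hi => ?_, fun i hi => ?_⟩
    · by_cases hij : i = j
      · simpa [hij] using hx.2
      · simpa [hij] using hx.1.1 i (by simp [hij, hi])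
    · have hij : i ≠ j := fun h => hi (h ▸ hj)
      simpa [hij] using hx.1.2 i (by simp [hi])
  · intro x _
    simp
  · rintro ⟨x, s⟩ hx
    rw [mem_product, mem_partialPi] at hx
    have := hx.1.2 j (by simp)
    simp [← this]
  · intro x _
    simp

lemma sum_range_telescope (u : ℕ → ZMod 2) (M : ℕ) :
    ∑ s ∈ range M, (u (s + 1) + u s) = u M + u 0 := by
  induction M with
  | zero => simp [CharTwo.add_self_eq_zero]
  | succ M ih =>
    rw [sum_range_succ, ih]
    linear_combination CharTwo.add_self_eq_zero (u M)

lemma sum_add_single {M : ℕ} {S : Finset ι} {j : ι} (hj : j ∈ S) (g : (ι → ℕ) → ZMod 2)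
    (hg : ∀ x, x j = M → g x = 0) :
    ∑ x ∈ partialPi (range M) 0 S, (g (x + Pi.single j 1) + g x) =
      ∑ x ∈ partialPi (range M) 0 (S.erase j), g x := by
  rw [sum_partialPi _ _ hj]
  refine sum_congr rfl fun x hx => ?_
  have hx0 : x j = 0 := (mem_partialPi.1 hx).2 j (by simp)
  have hupd : ∀ s, Function.update x j s + Pi.single j 1 = Function.update x j (s + 1) := by
    intro s
    ext k
    by_cases hk : k = j
    · subst hk; simp
    · simp [hk]
  simp only [hupd]
  rw [sum_range_telescope (fun s => g (Function.update x j s)), hg _ (by simp), zero_add,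
    ← hx0, Function.update_eq_self]

/-- Sign vectors on `S`, extended by `1`. -/
abbrev signs (S : Finset ι) : Finset (ι → ℤ) := partialPi {1, -1} 1 S

lemma abs_eq_one_of_mem_signs {S : Finset ι} {ε : ι → ℤ} (hε : ε ∈ signs S) (k : ι) :
    |ε k| = 1 := by
  rw [mem_partialPi] at hε
  by_cases hk : k ∈ S
  · have := hε.1 k hk
    simp only [mem_insert, mem_singleton] at this
    rcases this with h | h <;> simp [h]
  · simp [hε.2 k hk]

lemma sum_signs {M : Type*} [AddCommMonoid M] {S : Finset ι} {j : ι} (hj : j ∈ S)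
    (h : (ι → ℤ) → M) :
    ∑ ε ∈ signs S, h ε =
      ∑ ε ∈ signs (S.erase j), (h ε + h (Function.update ε j (-1))) := by
  rw [signs, sum_partialPi _ _ hj]
  refine sum_congr rfl fun ε hε => ?_
  have h1 : ε j = 1 := (mem_partialPi.1 hε).2 j (by simp)
  rw [sum_pair (by norm_num), ← h1, Function.update_eq_self, h1]

lemma sum_signs_coboundary {M : ℕ} {S : Finset ι} {i : ι} (hi : i ∈ S)
    (ψ : (ι → ℤ) → (ι → ℕ) → Finset ι → ZMod 2)
    (hvanish : ∀ ε ∈ signs (S.erase i), ∀ x T j, x j = M → ψ ε x T = 0)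
    (hlocal : ∀ ε x T j s, x j = 0 → j ∉ T → ψ (Function.update ε j s) x T = ψ ε x T) :
    ∑ ε ∈ signs (S.erase i), ∑ x ∈ partialPi (range M) 0 S, coboundary (ψ ε) x S =
      ∑ ε ∈ signs (S.erase i), ∑ x ∈ partialPi (range M) 0 (S.erase i), ψ ε x (S.erase i) := by
  have hfaces : ∀ ε ∈ signs (S.erase i), ∑ x ∈ partialPi (range M) 0 S, coboundary (ψ ε) x S =
      ∑ j ∈ S, ∑ x ∈ partialPi (range M) 0 (S.erase j), ψ ε x (S.erase j) := by
    intro ε hε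
    simp only [coboundary]
    rw [sum_comm]
    refine sum_congr rfl fun j hj => ?_
    exact sum_add_single hj (fun x => ψ ε x (S.erase j)) fun x hx => hvanish ε hε x _ j hx
  rw [sum_congr rfl hfaces, sum_comm]
  refine sum_eq_single_of_mem i hi fun j hj hji => ?_
  rw [sum_signs (mem_erase.2 ⟨hji, hj⟩)]
  refine sum_eq_zero fun ε _ => ?_
  rw [← sum_add_distrib]
  refine sum_eq_zero fun x hx => ?_
  rw [hlocal ε x _ j (-1) ((mem_partialPi.1 hx).2 j (by simp)) (by simp),
    CharTwo.add_self_eq_zero]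

lemma sum_signs_symm {M : Type*} [AddCommMonoid M] {S : Finset ι} {i : ι} (hi : i ∈ S)
    (h : (ι → ℤ) → M) :
    ∑ ε ∈ signs S, h ε =
      ∑ ε ∈ signs (S.erase i), (h ε + h (fun k => if k ∈ S then -ε k else ε k)) := by
  rw [sum_signs hi, sum_add_distrib, sum_add_distrib]
  congr 1
  have hneg : ∀ ε ∈ signs (S.erase i),
      (fun k => if k ∈ S.erase i then -ε k else ε k) ∈ signs (S.erase i) := by
    intro ε hε
    rw [mem_partialPi] at hε ⊢
    refine ⟨fun k hk => ?_, fun k hk => ?_⟩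
    · have := hε.1 k hk
      simp only [if_pos hk]
      simp only [mem_insert, mem_singleton] at this ⊢
      omega
    · simpa only [if_neg hk] using hε.2 k hk
  refine sum_nbij' (fun ε k => if k ∈ S.erase i then -ε k else ε k)
    (fun ε k => if k ∈ S.erase i then -ε k else ε k) hneg hneg ?_ ?_ ?_
  · intro ε _
    ext k
    by_cases hk : k ∈ S.erase i <;> simp only [hk, if_true, if_false, neg_neg]
  · intro ε _
    ext k
    by_cases hk : k ∈ S.erase i <;> simp only [hk, if_true, if_false, neg_neg]
  · intro ε hε
    congr 1
    ext k
    by_cases hk : k = i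
    · subst hk
      have := (mem_partialPi.1 hε).2 k (by simp)
      simp [hi, this]
    · by_cases hkS : k ∈ S <;> simp [hk, hkS]

/-- The number modulo `2` of cells of the half-space `{x i ≥ 0}` on which the given
`0`-cochains all vary, counted in directions `S` within the box of size `M`. -/
def halfSum (M : ℕ) (S : Finset ι) (i : ι) (L : List ((ι → ℤ) → ZMod 2)) : ZMod 2 :=
  ∑ ε ∈ signs (S.erase i), ∑ x ∈ partialPi (range M) 0 S, cupCoboundary (L.map (pull ε)) x S

lemma halfSum_cons {M : ℕ} {S : Finset ι} {i : ι} (hi : i ∈ S)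
    (a : (ι → ℤ) → ZMod 2) (L : List ((ι → ℤ) → ZMod 2))
    {ρ : (ι → ℤ) → ZMod 2} (hρ : ρ ∈ a :: L)
    (hfar : ∀ (v : ι → ℤ) (j : ι), (M : ℤ) ≤ |v j| → ρ v = 0) :
    halfSum M S i (a :: L) =
      ∑ ε ∈ signs (S.erase i), ∑ x ∈ partialPi (range M) 0 (S.erase i),
        pull ε a x * cupCoboundary (L.map (pull ε)) x (S.erase i) := by
  simp only [halfSum, List.map_cons, cupCoboundary_cons]
  refine sum_signs_coboundary hi
    (fun ε y T => pull ε a y * cupCoboundary (L.map (pull ε)) y T) ?_ ?_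
  · intro ε hε x T j hx
    have hfar' : ∀ y : ι → ℕ, M ≤ y j → pull ε ρ y = 0 := fun y hy =>
      hfar _ j (by simpa [orthantPoint, abs_mul, abs_eq_one_of_mem_signs hε] using hy)
    rcases List.mem_cons.1 hρ with rfl | hρ
    · simp only [hfar' x hx.ge, zero_mul]
    · rw [cupCoboundary_eq_zero_of_const (List.mem_map_of_mem hρ) (c := 0), mul_zero]
      intro y hy
      exact hfar' y (hx.ge.trans (hy j).1)
  · intro ε x T j s hx hj
    have hpull : ∀ y ∈ cube x T, ∀ b, pull (Function.update ε j s) b y = pull ε b y := by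
      intro y hy b
      have hyj : y j = 0 := by
        have := (hy j).2
        simpa [hx, hj] using this
      simp only [pull, orthantPoint_update s hyj]
    rw [hpull x (self_mem_cube x T),
      cupCoboundary_map_congr fun b _ => ⟨0, fun y hy => by rw [hpull y hy, add_zero]⟩]

lemma sum_signs_eq_halfSum {M : ℕ} {S : Finset ι} {i : ι} (hi : i ∈ S)
    (a : (ι → ℤ) → ZMod 2) (L : List ((ι → ℤ) → ZMod 2)) (ρ : (ι → ℤ) → ZMod 2)
    (hodd : ∀ b ∈ a :: L, ∀ v, v ≠ 0 → b (-v) = b v + 1)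
    (heven : ∀ v, ρ (-v) = ρ v)
    (hnear : ∀ v : ι → ℤ, (∀ k, |v k| ≤ 1) → ρ v = 1) :
    ∑ ε ∈ signs S, ∑ x ∈ partialPi (range M) 0 S,
        pull ε a x * cupCoboundary ((L ++ [ρ]).map (pull ε)) x S =
      halfSum M S i (L ++ [ρ]) := by
  rw [sum_signs_symm hi, halfSum]
  refine sum_congr rfl fun ε hε => ?_
  rw [← sum_add_distrib]
  refine sum_congr rfl fun x hx => ?_
  rw [mem_partialPi] at hx
  have habs : ∀ k, |ε k| = 1 := abs_eq_one_of_mem_signs hε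
  have hne : ∀ k, ε k ≠ 0 := fun k h => by simpa [h] using habs k
  set ε' : ι → ℤ := fun k => if k ∈ S then -ε k else ε k with hε'
  have habs' : ∀ k, |ε' k| = 1 := by
    intro k
    by_cases hk : k ∈ S <;> simp [hε', hk, habs]
  have hneg : ∀ y ∈ cube x S, orthantPoint ε' y = -orthantPoint ε y := by
    intro y hy
    ext k
    by_cases hk : k ∈ S
    · simp [orthantPoint, hε', hk]
    · have : y k = 0 := by
        have := (hy k).2
        simpa [hx.2 k hk, hk] using this
      simp [orthantPoint, this]
  by_cases hx0 : x = 0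
  · have hzero : ∀ η : ι → ℤ, (∀ k, |η k| = 1) →
        cupCoboundary ((L ++ [ρ]).map (pull η)) x S = 0 := by
      intro η hη
      refine cupCoboundary_eq_zero_of_const (a := pull η ρ) (c := 1)
        (List.mem_map_of_mem (by simp)) fun y hy => hnear _ fun k => ?_
      have h2 := (hy k).2
      have h3 : y k ≤ 1 := by
        rw [hx0] at h2
        split_ifs at h2 <;> simp at h2 <;> omega
      simp only [orthantPoint, abs_mul, hη, one_mul]
      simpa using h3
    rw [hzero ε habs, hzero ε' habs']
    simp
  · have hpt : ∀ y ∈ cube x S, orthantPoint ε y ≠ 0 := by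
      intro y hy h
      refine hx0 (funext fun k => ?_)
      have hk := congrFun h k
      simp only [orthantPoint, Pi.zero_apply, mul_eq_zero, hne k, false_or,
        Nat.cast_eq_zero] at hk
      exact Nat.le_zero.1 (hk ▸ (hy k).1)
    have hcongr : cupCoboundary ((L ++ [ρ]).map (pull ε')) x S =
        cupCoboundary ((L ++ [ρ]).map (pull ε)) x S := by
      refine cupCoboundary_map_congr fun b hb => ?_
      rcases List.mem_append.1 hb with hb | hb
      · refine ⟨1, fun y hy => ?_⟩
        simp only [pull]
        rw [hneg y hy, hodd b (List.mem_cons_of_mem _ hb) _ (hpt y hy)]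
      · refine ⟨0, fun y hy => ?_⟩
        rw [List.mem_singleton.1 hb]
        simp only [pull]
        rw [hneg y hy, heven, add_zero]
    have ha : pull ε' a x = pull ε a x + 1 := by
      simp only [pull]
      rw [hneg x (self_mem_cube x S), hodd a List.mem_cons_self _ (hpt x (self_mem_cube x S))]
    rw [hcongr, ha]
    linear_combination cupCoboundary ((L ++ [ρ]).map (pull ε)) x S *
      CharTwo.add_self_eq_zero (pull ε a x)

/-- A modulo `2` count of Borsuk–Ulam type. -/
theorem halfSum_eq_one {M : ℕ} (L : List ((ι → ℤ) → ZMod 2)) (ρ : (ι → ℤ) → ZMod 2)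
    (hodd : ∀ b ∈ L, ∀ v, v ≠ 0 → b (-v) = b v + 1)
    (heven : ∀ v, ρ (-v) = ρ v)
    (hnear : ∀ v : ι → ℤ, (∀ k, |v k| ≤ 1) → ρ v = 1)
    (hfar : ∀ (v : ι → ℤ) (j : ι), (M : ℤ) ≤ |v j| → ρ v = 0)
    {S : Finset ι} {i : ι} (hi : i ∈ S) (hcard : S.card = L.length + 1) :
    halfSum M S i (L ++ [ρ]) = 1 := by
  induction L generalizing S i with
  | nil =>
    rw [List.nil_append, halfSum_cons hi ρ [] List.mem_cons_self hfar]
    have hS : S.erase i = ∅ := by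
      rw [← card_eq_zero, card_erase_of_mem hi, hcard]
      rfl
    have hzero : ∀ {β : Type} (T : Finset β) (t : β),
        partialPi T t (∅ : Finset ι) = {fun _ => t} := by
      intro β T t
      ext x
      simp [mem_partialPi, funext_iff]
    rw [hS, signs, hzero, hzero, sum_singleton, sum_singleton]
    simp only [List.map_nil, cupCoboundary, mul_one, pull]
    exact hnear _ fun k => by simp [orthantPoint]
  | cons a L ih =>
    have hc : (S.erase i).card = L.length + 1 := by
      rw [card_erase_of_mem hi, hcard]
      rfl
    obtain ⟨i', hi'⟩ : (S.erase i).Nonempty := by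
      rw [← card_pos, hc]
      omega
    rw [List.cons_append, halfSum_cons hi a (L ++ [ρ]) (by simp) hfar,
      sum_signs_eq_halfSum hi' a L ρ hodd heven hnear]
    exact ih (fun b hb => hodd b (List.mem_cons_of_mem _ hb)) hi' hc

/-- For odd two-valued cochains and an even bounded region around the origin, one fewer cochain
than the dimension, some cell meets both values of all of them. -/
theorem exists_cell {M : ℕ} (L : List ((ι → ℤ) → ZMod 2)) (ρ : (ι → ℤ) → ZMod 2)
    (hodd : ∀ b ∈ L, ∀ v, v ≠ 0 → b (-v) = b v + 1)
    (heven : ∀ v, ρ (-v) = ρ v)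
    (hnear : ∀ v : ι → ℤ, (∀ k, |v k| ≤ 1) → ρ v = 1)
    (hfar : ∀ (v : ι → ℤ) (j : ι), (M : ℤ) ≤ |v j| → ρ v = 0)
    (hcard : Fintype.card ι = L.length + 1) :
    ∃ p : ι → ℤ, ∀ b ∈ L ++ [ρ], ∀ c, ∃ v : ι → ℤ, (∀ k, |v k - p k| ≤ 1) ∧ b v = c := by
  obtain ⟨i⟩ : Nonempty ι := Fintype.card_pos_iff.1 (by omega)
  have hone := halfSum_eq_one L ρ hodd heven hnear hfar (mem_univ i) hcard
  obtain ⟨ε, hε, h⟩ := exists_ne_zero_of_sum_ne_zero (hone ▸ one_ne_zero)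
  obtain ⟨x, -, h⟩ := exists_ne_zero_of_sum_ne_zero h
  refine ⟨orthantPoint ε x, fun b hb c => ?_⟩
  by_contra! hcon
  refine h (cupCoboundary_eq_zero_of_const (List.mem_map_of_mem hb) (c := c + 1) fun y hy => ?_)
  have hne : b (orthantPoint ε y) ≠ c := by
    refine hcon _ fun k => ?_
    have hk := hy k
    simp only [mem_univ, if_true] at hk
    simp only [orthantPoint]
    rw [← mul_sub, abs_mul, abs_eq_one_of_mem_signs hε, one_mul, abs_le]
    omega
  have htwo : ∀ s t : ZMod 2, s ≠ t → s = t + 1 := by decide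
  exact htwo _ _ hne

end CubicalCochain

section BorsukUlam

variable {ι : Type*} [Fintype ι]

/-- A Borsuk–Ulam theorem for a bounded symmetric open neighborhood of the origin: fewer odd
functions than the dimension have a common zero on its frontier. -/
theorem exists_mem_frontier_forall_eq_zero {n : ℕ} (hn : Fintype.card ι = n + 1)
    {V : Set (ι → ℝ)} (hopen : IsOpen V) (hbdd : Bornology.IsBounded V)
    (hsymm : ∀ x ∈ V, -x ∈ V) (h0 : (0 : ι → ℝ) ∈ V) (g : Fin n → (ι → ℝ) → ℝ)
    (hg : ∀ j, Continuous (g j)) (hodd : ∀ j x, g j (-x) = -g j x) :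
    ∃ x ∈ frontier V, ∀ j, g j x = 0 := by
  classical
  by_contra! hcon
  let good : Set (ι → ℝ) → Prop := fun U =>
    U ⊆ V ∨ U ⊆ Vᶜ ∨ ∃ j, (∀ u ∈ U, 0 < g j u) ∨ ∀ u ∈ U, g j u < 0
  have hcover : ∀ p, ∃ U, IsOpen U ∧ good U ∧ p ∈ U := by
    intro p
    by_cases hp : p ∈ frontier V
    · obtain ⟨j, hj⟩ := hcon p hp
      rcases lt_or_gt_of_ne hj with hj | hj
      · exact ⟨{u | g j u < 0}, isOpen_lt (hg j) continuous_const,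
          Or.inr (Or.inr ⟨j, Or.inr fun u hu => hu⟩), hj⟩
      · exact ⟨{u | 0 < g j u}, isOpen_lt continuous_const (hg j),
          Or.inr (Or.inr ⟨j, Or.inl fun u hu => hu⟩), hj⟩
    · by_cases hpV : p ∈ V
      · exact ⟨V, hopen, Or.inl subset_rfl, hpV⟩
      · refine ⟨(closure V)ᶜ, isClosed_closure.isOpen_compl,
          Or.inr (Or.inl (Set.compl_subset_compl.2 subset_closure)), fun hpc => hp ?_⟩
        rw [hopen.frontier_eq]
        exact ⟨hpc, hpV⟩
  obtain ⟨R, hR⟩ := hbdd.subset_closedBall 0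
  obtain ⟨δ, hδ, hleb⟩ := lebesgue_number_lemma_of_metric_sUnion
    (c := {U | IsOpen U ∧ good U}) (isCompact_closedBall (0 : ι → ℝ) (R + 1))
    (fun U hU => hU.1) (fun p _ => by
      obtain ⟨U, hU, hgood, hp⟩ := hcover p
      exact ⟨U, ⟨hU, hgood⟩, hp⟩)
  obtain ⟨r, hr, hrV⟩ := Metric.isOpen_iff.1 hopen 0 h0
  obtain ⟨t, ht0, ht⟩ : ∃ t : ℝ, 0 < t ∧ t < min δ (min r 1) :=
    exists_between (by positivity)
  have htδ : t < δ := ht.trans_le (min_le_left _ _)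
  have htr : t < r := ht.trans_le ((min_le_right _ _).trans (min_le_left _ _))
  have ht1 : t < 1 := ht.trans_le ((min_le_right _ _).trans (min_le_right _ _))
  obtain ⟨M, hM⟩ := exists_nat_gt (R / t)
  let q : (ι → ℤ) → ι → ℝ := fun v k => t * v k
  have hqneg : ∀ v, q (-v) = -q v := fun v => by ext k; simp [q]
  have hqdist : ∀ v p : ι → ℤ, (∀ k, |v k - p k| ≤ 1) → dist (q v) (q p) ≤ t := by
    intro v p h
    refine (dist_pi_le_iff ht0.le).2 fun k => ?_
    rw [Real.dist_eq, ← mul_sub, abs_mul, abs_of_pos ht0]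
    have : |(v k : ℝ) - p k| ≤ 1 := by exact_mod_cast h k
    nlinarith
  have hq0 : q 0 = 0 := by ext k; simp [q]
  let e : ι ≃ Fin (Fintype.card ι) := Fintype.equivFin ι
  let positive : (ι → ℤ) → Prop := fun v => 0 < toLex fun k => v (e.symm k)
  have hpositive : ∀ v, v ≠ 0 → (positive (-v) ↔ ¬ positive v) := by
    intro v hv
    have hne : toLex (fun k => v (e.symm k)) ≠ 0 := by
      intro h
      refine hv (funext fun i => ?_)
      have := congrFun (toLex.injective h) (e i)
      simpa using this
    have hneg : toLex (fun k => (-v) (e.symm k)) = -toLex (fun k => v (e.symm k)) := rfl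
    simp only [positive]
    rw [hneg]
    exact neg_pos.trans ⟨not_lt_of_gt, fun h => (le_of_not_gt h).lt_of_ne hne⟩
  let α : Fin n → (ι → ℤ) → ZMod 2 := fun j v =>
    if 0 < g j (q v) ∨ g j (q v) = 0 ∧ positive v then 1 else 0
  let ρ : (ι → ℤ) → ZMod 2 := fun v => if q v ∈ V then 1 else 0
  have hVneg : ∀ x, -x ∈ V ↔ x ∈ V :=
    fun x => ⟨fun h => by simpa using hsymm _ h, hsymm x⟩
  obtain ⟨p, hp⟩ := CubicalCochain.exists_cell (M := M) (List.ofFn α) ρ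
    (by
      intro b hb v hv
      obtain ⟨j, rfl⟩ := (List.mem_ofFn' _ _).1 hb
      simp only [α, hqneg, hodd, hpositive v hv, neg_eq_zero, neg_pos]
      have htwo : (1 : ZMod 2) + 1 = 0 := rfl
      rcases lt_trichotomy (g j (q v)) 0 with h | h | h
      · simp [h, h.ne, h.not_gt]
      · by_cases hpos : positive v <;> simp [h, hpos, htwo]
      · simp [h, h.ne', h.not_gt, htwo])
    (by
      intro v
      simp only [ρ, hqneg, hVneg])
    (by
      intro v hv
      refine if_pos (hrV ?_)
      have := hqdist v 0 (by simpa using hv)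
      rw [hq0] at this
      exact Metric.mem_ball.2 (this.trans_lt htr))
    (by
      intro v j hv
      refine if_neg fun hmem => ?_
      have h1 : ‖q v‖ ≤ R := by simpa using hR hmem
      have h2 : |t * (v j : ℝ)| ≤ R := (norm_le_pi_norm (q v) j).trans h1
      rw [abs_mul, abs_of_pos ht0] at h2
      have h3 : (M : ℝ) ≤ |(v j : ℝ)| := by exact_mod_cast hv
      rw [div_lt_iff₀ ht0] at hM
      nlinarith)
    (by simpa using hn)
  have hball : ∀ v : ι → ℤ, (∀ k, |v k - p k| ≤ 1) → q v ∈ Metric.ball (q p) δ :=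
    fun v hv => Metric.mem_ball.2 ((hqdist v p hv).trans_lt htδ)
  obtain ⟨v₁, hv₁, hρ₁⟩ := hp ρ (by simp) 1
  obtain ⟨v₀, hv₀, hρ₀⟩ := hp ρ (by simp) 0
  have hin : q v₁ ∈ V := by
    by_contra h
    simp [ρ, h] at hρ₁
  have hout : q v₀ ∉ V := by
    intro h
    simp [ρ, h] at hρ₀
  have hpK : q p ∈ Metric.closedBall (0 : ι → ℝ) (R + 1) := by
    have h1 := Metric.mem_closedBall.1 (hR hin)
    have h2 := hqdist v₁ p hv₁
    have h3 := dist_triangle_left (q p) 0 (q v₁)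
    exact Metric.mem_closedBall.2 (by linarith)
  obtain ⟨U, ⟨-, hgood⟩, hU⟩ := hleb (q p) hpK
  rcases hgood with h | h | ⟨j, h⟩
  · exact hout (h (hU (hball v₀ hv₀)))
  · exact h (hU (hball v₁ hv₁)) hin
  · have hj : α j ∈ List.ofFn α ++ [ρ] :=
      List.mem_append_left _ ((List.mem_ofFn' _ _).2 ⟨j, rfl⟩)
    rcases h with h | h
    · obtain ⟨v, hv, hα⟩ := hp _ hj 0
      simp [α, h _ (hU (hball v hv))] at hα
    · obtain ⟨v, hv, hα⟩ := hp _ hj 1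
      have hneg := h _ (hU (hball v hv))
      simp [α, hneg.not_gt, hneg.ne] at hα

end BorsukUlam

/-- If `V ⊂ ℝ^N` is a bounded symmetric open neighborhood of `0`, then the Krasnoselskii
genus of `∂V` is `N`: the identity is a continuous odd map `∂V → ℝ^N \ {0}`, and for
`m < N` there is no continuous odd map `∂V → ℝ^m \ {0}`. -/
theorem genus_frontier_eq_dim {N : ℕ} (V : Set (Fin N → ℝ))
    (hopen : IsOpen V) (hbdd : Bornology.IsBounded V)
    (hsymm : ∀ x ∈ V, -x ∈ V) (h0 : (0 : Fin N → ℝ) ∈ V) :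
    (∃ f : (Fin N → ℝ) → (Fin N → ℝ), ContinuousOn f (frontier V) ∧
      (∀ x ∈ frontier V, f x ≠ 0) ∧ (∀ x ∈ frontier V, f (-x) = -f x)) ∧
    (∀ m : ℕ, m < N →
      ¬ ∃ f : (Fin N → ℝ) → (Fin m → ℝ), ContinuousOn f (frontier V) ∧
        (∀ x ∈ frontier V, f x ≠ 0) ∧ (∀ x ∈ frontier V, f (-x) = -f x)) := by
  have hfrontier : ∀ x ∈ frontier V, x ∉ V := fun x hx => by
    rw [hopen.frontier_eq] at hx
    exact hx.2
  refine ⟨⟨id, continuousOn_id, fun x hx h => hfrontier x hx ((show x = 0 from h) ▸ h0), fun _ _ => rfl⟩, ?_⟩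
  rintro m hm ⟨f, hf, hf0, hfodd⟩
  obtain ⟨n, rfl⟩ : ∃ n, N = n + 1 := ⟨N - 1, by omega⟩
  obtain ⟨F, hF⟩ := ContinuousMap.exists_restrict_eq isClosed_frontier
    (⟨(frontier V).domRestrict f, hf.domRestrict⟩ : C(frontier V, Fin m → ℝ))
  have hFf : ∀ x ∈ frontier V, F x = f x := fun x hx => DFunLike.congr_fun hF ⟨x, hx⟩
  have hVneg : -V = V :=
    Set.ext fun x => ⟨fun h => by simpa using hsymm _ (Set.mem_neg.1 h), hsymm x⟩
  have hneg : ∀ x ∈ frontier V, -x ∈ frontier V := by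
    intro x hx
    have h := (Homeomorph.neg (Fin (n + 1) → ℝ)).preimage_frontier V
    have hpre : (Homeomorph.neg (Fin (n + 1) → ℝ)) ⁻¹' V = V := hVneg
    rw [hpre] at h
    exact h.ge hx
  obtain ⟨x, hx, hzero⟩ := exists_mem_frontier_forall_eq_zero (n := n) (by simp) hopen hbdd
    hsymm h0 (fun j x => if h : (j : ℕ) < m then F x ⟨j, h⟩ - F (-x) ⟨j, h⟩ else 0)
    (by
      intro j
      by_cases h : (j : ℕ) < m
      · simp only [h, dif_pos]
        fun_prop
      · simp only [h, dif_neg, not_false_eq_true]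
        fun_prop)
    (by
      intro j x
      by_cases h : (j : ℕ) < m <;> simp [h])
  refine hf0 x hx (funext fun j => ?_)
  have hj := hzero ⟨j, by omega⟩
  simp only [j.2, dif_pos, hFf x hx, hFf _ (hneg x hx), hfodd x hx, Pi.neg_apply,
    Fin.eta] at hj
  simp only [Pi.zero_apply]
  linarith
end

section
/- Let X be a real Banach space, k ∈ ℕ, Y^k a k-dimensional linear subspace of X, and R_k > 0. Set D_k = {u ∈ Y^k : ‖u‖ ≤ R_k}, and let h : D_k → X be a continuous map that is odd (h(−u) = −h(u) for all u ∈ D_k) and satisfies h(u) = u for every u ∈ Y^k with ‖u‖ = R_k. Let Y be a closed linear subspace of X whose codimension (the dimension of X/Y) is finite and strictly less than k. Then for every R with 0 < R < R_k there exists u ∈ D_k such that h(u) ∈ Y and ‖h(u)‖ = R; in other words, h(D_k) ∩ ∂B_R ∩ Y ≠ ∅, where ∂B_R = {v ∈ X : ‖v‖ = R}. -/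
section BorsukUlam

open Finset

section Chains

variable {V : Type*}

/-- The boundary of a chain with coefficients in `ZMod 2`; simplices are finite sets of vertices. -/
noncomputable def chainBoundary (V : Type*) [DecidableEq V] :
    (Finset V →₀ ZMod 2) →ₗ[ZMod 2] (Finset V →₀ ZMod 2) :=
  Finsupp.linearCombination (ZMod 2) fun σ => ∑ v ∈ σ, Finsupp.single (σ.erase v) 1

theorem chainBoundary_single [DecidableEq V] (σ : Finset V) :
    chainBoundary V (Finsupp.single σ 1) = ∑ v ∈ σ, Finsupp.single (σ.erase v) 1 := by
  simp [chainBoundary]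

theorem chain_add_self (c : Finset V →₀ ZMod 2) : c + c = 0 := by
  ext σ
  simpa using CharTwo.add_self_eq_zero (c σ)

theorem chainBoundary_chainBoundary [DecidableEq V] (c : Finset V →₀ ZMod 2) :
    chainBoundary V (chainBoundary V c) = 0 := by
  suffices h : (chainBoundary V).comp (chainBoundary V) = 0 from LinearMap.congr_fun h c
  refine Finsupp.lhom_ext' fun σ => LinearMap.ext_ring ?_
  simp only [LinearMap.comp_apply, Finsupp.lsingle_apply, chainBoundary_single, map_sum,
    LinearMap.zero_apply]
  rw [Finset.sum_sigma']
  refine Finset.sum_involution (fun p _ => ⟨p.2, p.1⟩) ?_ ?_ ?_ ?_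
  · rintro ⟨v, w⟩ _
    simp only [Finset.erase_right_comm (a := w) (b := v)]
    exact chain_add_self _
  · rintro ⟨v, w⟩ hp _ h
    simp only [mem_sigma, mem_erase] at hp
    simp only [Sigma.mk.injEq, heq_eq_eq] at h
    exact hp.2.1 h.1
  · rintro ⟨v, w⟩ hp
    simp only [mem_sigma, mem_erase] at hp ⊢
    exact ⟨hp.2.2, Ne.symm hp.2.1, hp.1⟩
  · rintro ⟨v, w⟩ _
    rfl

/-- The action of a vertex map on chains. -/
noncomputable def chainMap [DecidableEq V] (a : V → V) :
    (Finset V →₀ ZMod 2) →ₗ[ZMod 2] (Finset V →₀ ZMod 2) :=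
  Finsupp.lmapDomain (ZMod 2) (ZMod 2) (Finset.image a)

theorem chainMap_single [DecidableEq V] (a : V → V) (σ : Finset V) (x : ZMod 2) :
    chainMap a (Finsupp.single σ x) = Finsupp.single (σ.image a) x := by
  simp [chainMap, Finsupp.mapDomain_single]

theorem chainBoundary_chainMap [DecidableEq V] {a : V → V} (ha : Function.Injective a)
    (c : Finset V →₀ ZMod 2) :
    chainBoundary V (chainMap a c) = chainMap a (chainBoundary V c) := by
  suffices h : (chainBoundary V).comp (chainMap a) = (chainMap a).comp (chainBoundary V) from
    LinearMap.congr_fun h c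
  refine Finsupp.lhom_ext' fun σ => LinearMap.ext_ring ?_
  simp only [LinearMap.comp_apply, Finsupp.lsingle_apply, chainBoundary_single, map_sum,
    chainMap_single]
  rw [Finset.sum_image ha.injOn]
  simp only [Finset.image_erase ha]

/-- A simplex is alternating, starting with the sign `b`, if its vertices listed by increasing
rank `r` have signs `s` equal to `b, !b, b, …`. -/
def IsAlternating (r : V → ℕ) (s : V → Bool) (b : Bool) (σ : Finset V) : Prop :=
  ∀ v ∈ σ, (s v = b ↔ Even #{w ∈ σ | r w < r v})

open Classical in
/-- The indicator cochain of the alternating simplices. -/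
noncomputable def alternatingCochain (r : V → ℕ) (s : V → Bool) (b : Bool) (σ : Finset V) :
    ZMod 2 :=
  if IsAlternating r s b σ then 1 else 0

theorem isAlternating_insert_iff [DecidableEq V] {r : V → ℕ} {s : V → Bool} {b : Bool} {x : V}
    {σ : Finset V}
    (hx : ∀ v ∈ σ, r x < r v) :
    IsAlternating r s b (insert x σ) ↔ s x = b ∧ IsAlternating r s (!b) σ := by
  have hxσ : x ∉ σ := fun h => lt_irrefl _ (hx x h)
  have hcard : ∀ v ∈ σ, #{w ∈ insert x σ | r w < r v} = #{w ∈ σ | r w < r v} + 1 := by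
    intro v hv
    rw [Finset.filter_insert, if_pos (hx v hv), Finset.card_insert_of_notMem (by simp [hxσ])]
  have hcard0 : #{w ∈ insert x σ | r w < r x} = 0 := by
    rw [Finset.card_eq_zero, Finset.filter_eq_empty_iff]
    intro w hw
    rcases Finset.mem_insert.1 hw with rfl | hw
    · exact lt_irrefl _
    · exact (hx w hw).le.not_gt
  unfold IsAlternating
  rw [Finset.forall_mem_insert, hcard0]
  refine and_congr (by simp) (forall₂_congr fun v hv => ?_)
  rw [hcard v hv, Nat.even_add_one]
  cases s v <;> cases b <;> simp

theorem alternatingCochain_insert [DecidableEq V] {r : V → ℕ} {s : V → Bool} {b : Bool} {x : V}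
    {σ : Finset V}
    (hx : ∀ v ∈ σ, r x < r v) :
    alternatingCochain r s b (insert x σ) =
      if s x = b then alternatingCochain r s (!b) σ else 0 := by
  have h := isAlternating_insert_iff (s := s) (b := b) hx
  unfold alternatingCochain
  split_ifs <;> tauto

theorem alternatingCochain_empty (r : V → ℕ) (s : V → Bool) (b : Bool) :
    alternatingCochain r s b ∅ = 1 := by
  simp [alternatingCochain, IsAlternating]

/-- The coboundary of the cochain of alternating simplices. -/
theorem sum_alternatingCochain_erase [DecidableEq V] {r : V → ℕ} {s : V → Bool} (b : Bool)
    {σ : Finset V}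
    (hr : Set.InjOn r σ) :
    ∑ v ∈ σ, alternatingCochain r s b (σ.erase v) =
      alternatingCochain r s b σ + alternatingCochain r s (!b) σ := by
  induction σ using Finset.induction_on_min_value r generalizing b with
  | empty => simp [alternatingCochain_empty, CharTwo.add_self_eq_zero]
  | insert x σ hxσ hmin ih =>
    have hx : ∀ v ∈ σ, r x < r v := fun v hv =>
      lt_of_le_of_ne (hmin v hv) fun h => hxσ <| by
        rw [hr (by simp) (by simp [hv]) h]; exact hv
    have hih := ih (!b) (hr.mono (by simp))
    have hsum : ∑ v ∈ σ, alternatingCochain r s b ((insert x σ).erase v) =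
        if s x = b then ∑ v ∈ σ, alternatingCochain r s (!b) (σ.erase v) else 0 := by
      have hterm : ∀ v ∈ σ, alternatingCochain r s b ((insert x σ).erase v) =
          if s x = b then alternatingCochain r s (!b) (σ.erase v) else 0 := fun v hv => by
        rw [Finset.erase_insert_of_ne (by rintro rfl; exact hxσ hv),
          alternatingCochain_insert fun w hw => hx w (Finset.mem_of_mem_erase hw)]
      rw [Finset.sum_congr rfl hterm]
      split_ifs <;> simp
    rw [Finset.sum_insert hxσ, Finset.erase_insert hxσ, hsum, hih, alternatingCochain_insert hx,
      alternatingCochain_insert hx, Bool.not_not]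
    have h2 := CharTwo.add_self_eq_zero (alternatingCochain r s b σ)
    cases hs : s x <;> cases b <;> simp at h2 ⊢ <;> linear_combination h2

theorem alternatingCochain_image [DecidableEq V] {a : V → V} (ha : Function.Injective a) {r : V → ℕ}
    {s : V → Bool} {σ : Finset V} (hr : ∀ v ∈ σ, r (a v) = r v) (hs : ∀ v ∈ σ, s (a v) = !s v)
    (b : Bool) :
    alternatingCochain r s b (σ.image a) = alternatingCochain r s (!b) σ := by
  have : IsAlternating r s b (σ.image a) ↔ IsAlternating r s (!b) σ := by
    unfold IsAlternating
    rw [Finset.forall_mem_image]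
    refine forall₂_congr fun v hv => ?_
    rw [Finset.filter_image, Finset.card_image_of_injective _ ha, hs v hv, hr v hv,
      Finset.filter_congr fun w hw => by rw [hr w hw]]
    cases s v <;> cases b <;> simp
  unfold alternatingCochain
  split_ifs <;> tauto

/-- The value of a cochain on a chain. -/
noncomputable def chainEval (θ : Finset V → ZMod 2) : (Finset V →₀ ZMod 2) →ₗ[ZMod 2] ZMod 2 :=
  Finsupp.linearCombination (ZMod 2) θ

theorem chainEval_single (θ : Finset V → ZMod 2) (σ : Finset V) :
    chainEval θ (Finsupp.single σ 1) = θ σ := by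
  simp [chainEval]

theorem chainEval_congr {θ η : Finset V → ZMod 2} {c : Finset V →₀ ZMod 2}
    (h : ∀ σ ∈ c.support, θ σ = η σ) : chainEval θ c = chainEval η c := by
  simp only [chainEval, Finsupp.linearCombination_apply]
  exact Finset.sum_congr rfl fun σ hσ => by simp only [h σ hσ]

theorem chainEval_chainBoundary [DecidableEq V] (θ : Finset V → ZMod 2) (c : Finset V →₀ ZMod 2) :
    chainEval θ (chainBoundary V c) = chainEval (fun σ => ∑ v ∈ σ, θ (σ.erase v)) c := by
  suffices h : (chainEval θ).comp (chainBoundary V) =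
      chainEval (fun σ => ∑ v ∈ σ, θ (σ.erase v)) from LinearMap.congr_fun h c
  refine Finsupp.lhom_ext' fun σ => LinearMap.ext_ring ?_
  simp [chainBoundary_single, chainEval_single]

theorem chainEval_chainMap [DecidableEq V] (θ : Finset V → ZMod 2) (a : V → V)
    (c : Finset V →₀ ZMod 2) :
    chainEval θ (chainMap a c) = chainEval (fun σ => θ (σ.image a)) c := by
  suffices h : (chainEval θ).comp (chainMap a) = chainEval (fun σ => θ (σ.image a)) from
    LinearMap.congr_fun h c
  refine Finsupp.lhom_ext' fun σ => LinearMap.ext_ring ?_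
  simp [chainMap_single, chainEval_single]

theorem chainEval_add (θ η : Finset V → ZMod 2) (c : Finset V →₀ ZMod 2) :
    chainEval θ c + chainEval η c = chainEval (fun σ => θ σ + η σ) c := by
  simp [chainEval, Finsupp.linearCombination_apply, Finsupp.sum, mul_add, Finset.sum_add_distrib]

theorem exists_mem_support_of_mem_support_chainBoundary [DecidableEq V] {c : Finset V →₀ ZMod 2}
    {τ : Finset V}
    (hτ : τ ∈ (chainBoundary V c).support) : ∃ σ ∈ c.support, ∃ v ∈ σ, σ.erase v = τ := by
  by_contra! h
  refine Finsupp.mem_support_iff.1 hτ ?_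
  simp only [chainBoundary, Finsupp.linearCombination_apply, Finsupp.sum, Finsupp.finsetSum_apply,
    Finsupp.smul_apply]
  refine Finset.sum_eq_zero fun σ hσ => ?_
  rw [Finset.sum_eq_zero, smul_zero]
  exact fun v hv => Finsupp.single_eq_of_ne (h σ hσ v hv).symm

/-- A chain invariant under an involution without fixed simplices is of the form `c + a c`. -/
theorem exists_half_chain [DecidableEq V] {a : V → V} (ha : Function.Involutive a)
    {C : Finset V →₀ ZMod 2}
    (hC : chainMap a C = C) (hfree : ∀ σ ∈ C.support, σ.image a ≠ σ) :
    ∃ c : Finset V →₀ ZMod 2, c.support ⊆ C.support ∧ C = c + chainMap a c := by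
  classical
  have hinv : Function.Involutive (Finset.image a) := fun σ => by
    rw [Finset.image_image, ha.comp_self, Finset.image_id]
  have hmap : ∀ (c : Finset V →₀ ZMod 2) σ, chainMap a c σ = c (σ.image a) := fun c σ => by
    conv_lhs => rw [← hinv σ]
    exact Finsupp.mapDomain_apply hinv.injective c _
  refine ⟨C.filter fun σ => WellOrderingRel σ (σ.image a), by simp [Finsupp.support_filter], ?_⟩
  ext σ
  have hCσ : C (σ.image a) = C σ := by rw [← hmap, hC]
  rw [Finsupp.add_apply, hmap, Finsupp.filter_apply, Finsupp.filter_apply, hinv σ, hCσ]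
  by_cases hσ : C σ = 0
  · simp [hσ]
  · rcases trichotomous_of WellOrderingRel σ (σ.image a) with h | h | h
    · simp [h, asymm_of WellOrderingRel h]
    · exact absurd h.symm (hfree σ (by simpa using hσ))
    · simp [h, asymm_of WellOrderingRel h]

/-- For an invariant cycle, the number of alternating simplices modulo `2` does not depend on the
antipodal signs and ranks used to count them. -/
theorem chainEval_alternatingCochain_eq [DecidableEq V] {a : V → V} (ha : Function.Involutive a)
    {U : Set V}
    {r r' : V → ℕ} {s s' : V → Bool}
    (hr : ∀ v ∈ U, r (a v) = r v) (hs : ∀ v ∈ U, s (a v) = !s v)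
    (hr' : ∀ v ∈ U, r' (a v) = r' v) (hs' : ∀ v ∈ U, s' (a v) = !s' v)
    (n : ℕ) (b : Bool) (C : Finset V →₀ ZMod 2) (hcard : ∀ σ ∈ C.support, #σ = n)
    (hU : ∀ σ ∈ C.support, (σ : Set V) ⊆ U)
    (hinj : ∀ σ ∈ C.support, Set.InjOn r σ) (hinj' : ∀ σ ∈ C.support, Set.InjOn r' σ)
    (hsymm : chainMap a C = C) (hcycle : chainBoundary V C = 0) :
    chainEval (alternatingCochain r s b) C = chainEval (alternatingCochain r' s' b) C := by
  induction n generalizing C with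
  | zero =>
    refine chainEval_congr fun σ hσ => ?_
    rw [Finset.card_eq_zero.1 (hcard σ hσ), alternatingCochain_empty, alternatingCochain_empty]
  | succ n ih =>
    obtain ⟨c, hsub, hc⟩ := exists_half_chain ha hsymm fun σ hσ hfix => by
      obtain ⟨v, hv⟩ : σ.Nonempty := by rw [← Finset.card_pos, hcard σ hσ]; omega
      have hav : a v ∈ σ := by rw [← hfix]; exact Finset.mem_image_of_mem a hv
      have h1 := hs v (hU σ hσ hv)
      rw [hinj σ hσ hav hv (hr v (hU σ hσ hv))] at h1
      cases hsv : s v <;> simp [hsv] at h1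
    have key : ∀ (q : V → ℕ) (t : V → Bool), (∀ v ∈ U, q (a v) = q v) →
        (∀ v ∈ U, t (a v) = !t v) → (∀ σ ∈ C.support, Set.InjOn q σ) →
        chainEval (alternatingCochain q t b) C =
          chainEval (alternatingCochain q t b) (chainBoundary V c) := by
      intro q t hq ht hqinj
      rw [chainEval_chainBoundary]
      conv_lhs => rw [hc]
      rw [map_add, chainEval_chainMap, chainEval_add]
      refine chainEval_congr fun σ hσ => ?_
      rw [sum_alternatingCochain_erase b (hqinj σ (hsub hσ)),
        alternatingCochain_image ha.injective (fun v hv => hq v (hU σ (hsub hσ) hv))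
          (fun v hv => ht v (hU σ (hsub hσ) hv))]
    have hsubsimplex : ∀ τ ∈ (chainBoundary V c).support, ∃ σ ∈ C.support, τ ⊆ σ ∧ #τ = n := by
      intro τ hτ
      obtain ⟨σ, hσ, v, hv, rfl⟩ := exists_mem_support_of_mem_support_chainBoundary hτ
      refine ⟨σ, hsub hσ, Finset.erase_subset _ _, ?_⟩
      rw [Finset.card_erase_of_mem hv, hcard σ (hsub hσ), Nat.add_sub_cancel]
    rw [key r s hr hs hinj, key r' s' hr' hs' hinj']
    refine ih _ (fun τ hτ => (hsubsimplex τ hτ).choose_spec.2.2) ?_ ?_ ?_ ?_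
      (chainBoundary_chainBoundary c)
    · intro τ hτ
      obtain ⟨σ, hσ, h, -⟩ := hsubsimplex τ hτ
      exact (Finset.coe_subset.2 h).trans (hU σ hσ)
    · intro τ hτ
      obtain ⟨σ, hσ, h, -⟩ := hsubsimplex τ hτ
      exact (hinj σ hσ).mono (Finset.coe_subset.2 h)
    · intro τ hτ
      obtain ⟨σ, hσ, h, -⟩ := hsubsimplex τ hτ
      exact (hinj' σ hσ).mono (Finset.coe_subset.2 h)
    · rw [← chainBoundary_chainMap ha.injective]
      have h0 : chainBoundary V c + chainBoundary V (chainMap a c) = 0 := by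
        rw [← map_add, ← hc, hcycle]
      calc chainBoundary V (chainMap a c)
          = chainBoundary V c + (chainBoundary V c + chainBoundary V (chainMap a c)) := by
            rw [← add_assoc, chain_add_self, zero_add]
        _ = chainBoundary V c := by rw [h0, add_zero]

/-- An alternating simplex has at most one vertex with a given label, provided that vertices with
the same label have the same sign. -/
theorem IsAlternating.injOn_label [DecidableEq V] {r : V → ℕ} {s : V → Bool} {b : Bool}
    {σ : Finset V}
    (h : IsAlternating r s b σ) (hr : Set.InjOn r σ) {ℓ : V → ℕ}
    (hℓ : ∀ v ∈ σ, ∀ w ∈ σ, r v ≤ r w → ℓ v ≤ ℓ w)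
    (hs : ∀ v ∈ σ, ∀ w ∈ σ, ℓ v = ℓ w → s v = s w) : Set.InjOn ℓ σ := by
  have main : ∀ x ∈ σ, ∀ y ∈ σ, ℓ x = ℓ y → ¬ r x < r y := by
    intro x hx y hy hxy hlt
    obtain ⟨z, hz, hzmin⟩ := Finset.exists_min_image {w ∈ σ | r x < r w} r ⟨y, by simp [hy, hlt]⟩
    simp only [mem_filter] at hz hzmin
    have hzx : ℓ x = ℓ z := le_antisymm (hℓ x hx z hz.1 hz.2.le)
      (hxy ▸ hℓ z hz.1 y hy (hzmin y ⟨hy, hlt⟩))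
    have hset : {w ∈ σ | r w < r z} = insert x {w ∈ σ | r w < r x} := by
      ext w
      simp only [mem_filter, mem_insert]
      constructor
      · rintro ⟨hw, hwz⟩
        rcases lt_trichotomy (r w) (r x) with h1 | h1 | h1
        · exact Or.inr ⟨hw, h1⟩
        · exact Or.inl (hr hw hx h1)
        · exact absurd (hzmin w ⟨hw, h1⟩) hwz.not_ge
      · rintro (rfl | ⟨hw, hwx⟩)
        · exact ⟨hx, hz.2⟩
        · exact ⟨hw, hwx.trans hz.2⟩
    have h1 := h x hx
    have h2 := h z hz.1
    rw [hset, Finset.card_insert_of_notMem (by simp), Nat.even_add_one, ← hs x hx z hz.1 hzx] at h2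
    tauto
  intro x hx y hy hxy
  rcases lt_trichotomy (r x) (r y) with h1 | h1 | h1
  · exact absurd h1 (main x hx y hy hxy)
  · exact hr hx hy h1
  · exact absurd h1 (main y hy x hx hxy.symm)

end Chains

section CubicalGrid

variable {k : ℕ}

/-- Points of `Fin k → ℤ` encode the cells of a cubical grid of `ℝᵏ`: an even coordinate `2 n`
stands for the point `n`, an odd coordinate `2 n + 1` for the interval `(n, n + 1)`.
`IsFace x y` says that the cell `x` is a face of the cell `y`. -/
def IsFace (x y : Fin k → ℤ) : Prop :=
  ∀ i, x i = y i ∨ Odd (y i) ∧ (x i = y i + 1 ∨ x i = y i - 1)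

/-- The dimension of a cell of the cubical grid. -/
def cellDim (x : Fin k → ℤ) : ℕ := #{i | Odd (x i)}

/-- Flags of cells, that is, the simplices of the barycentric subdivision of the cubical grid. -/
def IsFlag (σ : Finset (Fin k → ℤ)) : Prop := ∀ x ∈ σ, ∀ y ∈ σ, IsFace x y ∨ IsFace y x

theorem IsFace.refl (x : Fin k → ℤ) : IsFace x x := fun _ => Or.inl rfl

theorem IsFace.trans {x y z : Fin k → ℤ} (hxy : IsFace x y) (hyz : IsFace y z) : IsFace x z := by
  intro i
  have h1 := hxy i
  have h2 := hyz i
  simp only [Int.odd_iff] at h1 h2 ⊢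
  omega

theorem IsFace.neg {x y : Fin k → ℤ} (h : IsFace x y) : IsFace (-x) (-y) := by
  intro i
  have h1 := h i
  simp only [Int.odd_iff, Pi.neg_apply] at h1 ⊢
  omega

theorem IsFace.abs_sub_le {x y : Fin k → ℤ} (h : IsFace x y) (i : Fin k) : |x i - y i| ≤ 1 := by
  rw [abs_le]
  have := h i
  omega

theorem cellDim_neg (x : Fin k → ℤ) : cellDim (-x) = cellDim x := by
  simp [cellDim, Int.odd_iff]

theorem cellDim_zero : cellDim (0 : Fin k → ℤ) = 0 := by
  simp [cellDim]

theorem cellDim_le (x : Fin k → ℤ) : cellDim x ≤ k :=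
  (Finset.card_le_univ _).trans_eq (Fintype.card_fin k)

theorem IsFace.odd_subset {x y : Fin k → ℤ} (h : IsFace x y) :
    ({i | Odd (x i)} : Finset (Fin k)) ⊆ ({i | Odd (y i)} : Finset (Fin k)) := by
  intro i hi
  have h1 := h i
  simp only [Int.odd_iff, mem_filter, mem_univ, true_and] at h1 hi ⊢
  omega

theorem IsFace.cellDim_le {x y : Fin k → ℤ} (h : IsFace x y) : cellDim x ≤ cellDim y :=
  Finset.card_le_card h.odd_subset

theorem IsFace.eq_of_cellDim_le {x y : Fin k → ℤ} (h : IsFace x y) (hd : cellDim y ≤ cellDim x) :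
    x = y := by
  have heq := Finset.eq_of_subset_of_card_le h.odd_subset hd
  ext i
  have h1 := h i
  have h2 : Odd (x i) ↔ Odd (y i) := by simpa using Finset.ext_iff.1 heq i
  simp only [Int.odd_iff] at h1 h2
  omega

theorem IsFace.cellDim_lt {x y : Fin k → ℤ} (h : IsFace x y) (hne : x ≠ y) :
    cellDim x < cellDim y := by
  by_contra! hd
  exact hne (h.eq_of_cellDim_le hd)

theorem IsFlag.isFace {σ : Finset (Fin k → ℤ)} (hσ : IsFlag σ) {x y : Fin k → ℤ} (hx : x ∈ σ)
    (hy : y ∈ σ) (hd : cellDim x ≤ cellDim y) : IsFace x y := by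
  rcases hσ x hx y hy with h | h
  · exact h
  · rw [h.eq_of_cellDim_le hd]
    exact IsFace.refl x

theorem IsFlag.injOn_cellDim {σ : Finset (Fin k → ℤ)} (hσ : IsFlag σ) :
    Set.InjOn cellDim (σ : Set (Fin k → ℤ)) :=
  fun _ hx _ hy hd => (hσ.isFace hx hy hd.le).eq_of_cellDim_le hd.ge

theorem IsFlag.mono {σ τ : Finset (Fin k → ℤ)} (hσ : IsFlag σ) (h : τ ⊆ σ) : IsFlag τ :=
  fun x hx y hy => hσ x (h hx) y (h hy)

theorem isFlag_insert {σ : Finset (Fin k → ℤ)} (hσ : IsFlag σ) {v : Fin k → ℤ}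
    (h : ∀ x ∈ σ, IsFace x v ∨ IsFace v x) : IsFlag (insert v σ) := by
  intro x hx y hy
  rcases Finset.mem_insert.1 hx with rfl | hx' <;> rcases Finset.mem_insert.1 hy with rfl | hy'
  · exact Or.inl (IsFace.refl _)
  · exact (h y hy').symm
  · exact h x hx'
  · exact hσ x hx' y hy'

theorem IsFlag.image_neg {σ : Finset (Fin k → ℤ)} (hσ : IsFlag σ) :
    IsFlag (σ.image fun x => -x) := by
  unfold IsFlag
  simp only [Finset.forall_mem_image]
  exact fun x hx y hy => (hσ x hx y hy).imp IsFace.neg IsFace.neg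

theorem IsFlag.image_cellDim {σ : Finset (Fin k → ℤ)} (hσ : IsFlag σ) (hcard : #σ = k + 1) :
    σ.image cellDim = Finset.range (k + 1) := by
  refine Finset.eq_of_subset_of_card_le ?_ ?_
  · intro d hd
    obtain ⟨x, -, rfl⟩ := Finset.mem_image.1 hd
    exact Finset.mem_range.2 (Nat.lt_succ_of_le (cellDim_le x))
  · rw [Finset.card_image_of_injOn hσ.injOn_cellDim, hcard, Finset.card_range]

theorem IsFlag.exists_cellDim_eq {σ : Finset (Fin k → ℤ)} (hσ : IsFlag σ) (hcard : #σ = k + 1)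
    {d : ℕ} (hd : d ≤ k) : ∃ x ∈ σ, cellDim x = d := by
  rw [← Finset.mem_image, hσ.image_cellDim hcard]
  exact Finset.mem_range.2 (Nat.lt_succ_of_le hd)

theorem IsFlag.card_filter_cellDim_lt {σ : Finset (Fin k → ℤ)} (hσ : IsFlag σ)
    (hcard : #σ = k + 1) (x : Fin k → ℤ) : #{w ∈ σ | cellDim w < cellDim x} = cellDim x := by
  have h : ({w ∈ σ | cellDim w < cellDim x}).image cellDim = Finset.range (cellDim x) := by
    ext d
    simp only [mem_image, mem_filter, mem_range]
    constructor
    · rintro ⟨w, ⟨-, hw⟩, rfl⟩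
      exact hw
    · intro hd
      obtain ⟨w, hw, rfl⟩ := hσ.exists_cellDim_eq hcard (hd.le.trans (cellDim_le x))
      exact ⟨w, ⟨hw, hd⟩, rfl⟩
  rw [← Finset.card_image_of_injOn (hσ.injOn_cellDim.mono (filter_subset _ _)), h,
    Finset.card_range]

/-- A codimension-one flag is contained in two maximal flags, which are exchanged by a point
reflection of the missing vertex. -/
theorem exists_flag_reflection (hk : 0 < k) (τ : Finset (Fin k → ℤ)) :
    ∃ z : Fin k → ℤ, ∀ v ∉ τ, IsFlag (insert v τ) → #(insert v τ) = k + 1 →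
      z - v ≠ v ∧ z - v ∉ τ ∧ IsFlag (insert (z - v) τ) := by
  by_cases hex : ∃ v ∉ τ, IsFlag (insert v τ) ∧ #(insert v τ) = k + 1
  swap
  · exact ⟨0, fun v hv h1 h2 => absurd ⟨v, hv, h1, h2⟩ hex⟩
  obtain ⟨v₀, hv₀, hflag₀, hcard₀⟩ := hex
  have hτ : IsFlag τ := hflag₀.mono (Finset.subset_insert _ _)
  have hdim : ∀ v ∉ τ, IsFlag (insert v τ) → #(insert v τ) = k + 1 → cellDim v = cellDim v₀ := by
    intro v hv h1 h2
    obtain ⟨x, hx, hxd⟩ := h1.exists_cellDim_eq h2 (cellDim_le v₀)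
    rcases Finset.mem_insert.1 hx with rfl | hx
    · exact hxd
    · have := hflag₀.injOn_cellDim (by simp [hx]) (by simp) hxd
      exact absurd (this ▸ hx) hv₀
  have hother : ∀ d ≤ k, d ≠ cellDim v₀ → ∃ x ∈ τ, cellDim x = d := by
    intro d hd hne
    obtain ⟨x, hx, hxd⟩ := hflag₀.exists_cellDim_eq hcard₀ hd
    rcases Finset.mem_insert.1 hx with rfl | hx
    · exact absurd hxd.symm hne
    · exact ⟨x, hx, hxd⟩
  have hmissing : ∀ x ∈ τ, cellDim x ≠ cellDim v₀ := fun x hx h =>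
    hv₀ (hflag₀.injOn_cellDim (by simp [hx]) (by simp) h ▸ hx)
  -- It suffices to control the faces and cofaces of the reflected vertex in the flag.
  suffices h : ∃ z : Fin k → ℤ, ∀ v ∉ τ, IsFlag (insert v τ) → cellDim v = cellDim v₀ →
      z - v ≠ v ∧ cellDim (z - v) = cellDim v₀ ∧
        ∀ x ∈ τ, IsFace x (z - v) ∨ IsFace (z - v) x by
    obtain ⟨z, hz⟩ := h
    refine ⟨z, fun v hv h1 h2 => ?_⟩
    obtain ⟨h3, h4, h5⟩ := hz v hv h1 (hdim v hv h1 h2)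
    exact ⟨h3, fun hmem => hmissing _ hmem h4, isFlag_insert hτ h5⟩
  rcases Nat.eq_zero_or_pos (cellDim v₀) with h0 | hpos
  · obtain ⟨q, hq, hqd⟩ := hother 1 hk (by omega)
    refine ⟨q + q, fun v hv hflag hvd => ?_⟩
    have hvq : IsFace v q := hflag.isFace (by simp) (by simp [hq]) (by omega)
    have hne : v ≠ q := by rintro rfl; exact hv hq
    have hface : IsFace (q + q - v) q := by
      intro i
      have := hvq i
      simp only [Pi.add_apply, Pi.sub_apply, Int.odd_iff] at this ⊢
      omega
    have hne' : q + q - v ≠ q := fun h => hne <| by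
      ext i
      have := congrFun h i
      simp only [Pi.add_apply, Pi.sub_apply] at this
      omega
    refine ⟨fun h => hne ?_, ?_, fun x hx => Or.inr (hface.trans (hτ.isFace hq hx ?_))⟩
    · ext i
      have := congrFun h i
      simp only [Pi.add_apply, Pi.sub_apply] at this
      omega
    · have := hface.cellDim_lt hne'
      omega
    · have := hmissing x hx
      omega
  rcases (cellDim_le v₀).eq_or_lt with htop | hlt
  · obtain ⟨p, hp, hpd⟩ := hother (k - 1) (by omega) (by omega)
    refine ⟨p + p, fun v hv hflag hvd => ?_⟩
    have hpv : IsFace p v := hflag.isFace (by simp [hp]) (by simp) (by omega)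
    have hne : v ≠ p := by rintro rfl; exact hv hp
    have hface : IsFace p (p + p - v) := by
      intro i
      have := hpv i
      simp only [Pi.add_apply, Pi.sub_apply, Int.odd_iff] at this ⊢
      omega
    have hne' : p ≠ p + p - v := fun h => hne <| by
      ext i
      have := congrFun h i
      simp only [Pi.add_apply, Pi.sub_apply] at this
      omega
    refine ⟨fun h => hne ?_, ?_, fun x hx => Or.inl ((hτ.isFace hx hp ?_).trans hface)⟩
    · ext i
      have := congrFun h i
      simp only [Pi.add_apply, Pi.sub_apply] at this
      omega
    · have := hface.cellDim_lt hne'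
      have := cellDim_le (p + p - v)
      omega
    · have := hmissing x hx
      have := cellDim_le x
      omega
  · obtain ⟨p, hp, hpd⟩ := hother (cellDim v₀ - 1) (by omega) (by omega)
    obtain ⟨q, hq, hqd⟩ := hother (cellDim v₀ + 1) (by omega) (by omega)
    refine ⟨p + q, fun v hv hflag hvd => ?_⟩
    have hpv : IsFace p v := hflag.isFace (by simp [hp]) (by simp) (by omega)
    have hvq : IsFace v q := hflag.isFace (by simp) (by simp [hq]) (by omega)
    have hnep : v ≠ p := by rintro rfl; exact hv hp
    have hneq : v ≠ q := by rintro rfl; exact hv hq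
    have hpface : IsFace p (p + q - v) := by
      intro i
      have h1 := hpv i
      have h2 := hvq i
      simp only [Pi.add_apply, Pi.sub_apply, Int.odd_iff] at h1 h2 ⊢
      omega
    have hqface : IsFace (p + q - v) q := by
      intro i
      have h1 := hpv i
      have h2 := hvq i
      simp only [Pi.add_apply, Pi.sub_apply, Int.odd_iff] at h1 h2 ⊢
      omega
    have hnep' : p ≠ p + q - v := fun h => hneq <| by
      ext i
      have := congrFun h i
      simp only [Pi.add_apply, Pi.sub_apply] at this
      omega
    have hneq' : p + q - v ≠ q := fun h => hnep <| by
      ext i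
      have := congrFun h i
      simp only [Pi.add_apply, Pi.sub_apply] at this
      omega
    refine ⟨fun h => hnep ?_, ?_, fun x hx => ?_⟩
    · ext i
      have h0 := congrFun h i
      have h1 := hpv i
      have h2 := hvq i
      simp only [Pi.add_apply, Pi.sub_apply, Int.odd_iff] at h0 h1 h2
      omega
    · have := hpface.cellDim_lt hnep'
      have := hqface.cellDim_lt hneq'
      omega
    · rcases lt_or_gt_of_ne (hmissing x hx) with h | h
      · exact Or.inl ((hτ.isFace hx hp (by omega)).trans hpface)
      · exact Or.inr (hqface.trans (hτ.isFace hq hx (by omega)))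

/-- The maximal flags having a vertex in `O`. -/
noncomputable def flagsMeeting (O : Finset (Fin k → ℤ)) : Finset (Finset (Fin k → ℤ)) :=
  open Classical in
  {σ ∈ (O.biUnion fun z => Finset.Icc (z - 1) (z + 1)).powerset |
    IsFlag σ ∧ #σ = k + 1 ∧ ∃ z ∈ σ, z ∈ O}

theorem mem_flagsMeeting {O : Finset (Fin k → ℤ)} {σ : Finset (Fin k → ℤ)} :
    σ ∈ flagsMeeting O ↔ IsFlag σ ∧ #σ = k + 1 ∧ ∃ z ∈ σ, z ∈ O := by
  classical
  simp only [flagsMeeting, mem_filter, mem_powerset, and_iff_right_iff_imp]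
  rintro ⟨hσ, -, z, hz, hzO⟩ x hx
  refine Finset.mem_biUnion.2 ⟨z, hzO, ?_⟩
  have h : ∀ i, |x i - z i| ≤ 1 := by
    intro i
    rcases hσ x hx z hz with h | h
    · exact h.abs_sub_le i
    · rw [abs_sub_comm]
      exact h.abs_sub_le i
  rw [Finset.mem_Icc]
  constructor <;> intro i <;> have := abs_le.1 (h i) <;> simp <;> omega

/-- The sum of the maximal flags having a vertex in `O`. -/
noncomputable def flagChain (O : Finset (Fin k → ℤ)) : Finset (Fin k → ℤ) →₀ ZMod 2 :=
  ∑ σ ∈ flagsMeeting O, Finsupp.single σ 1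

theorem chainBoundary_flagChain (hk : 0 < k) (O : Finset (Fin k → ℤ)) :
    chainBoundary _ (flagChain O) =
      ∑ p ∈ (flagsMeeting O).sigma (fun σ => σ) with Disjoint (p.1.erase p.2) O,
        Finsupp.single (p.1.erase p.2) 1 := by
  have hsum : chainBoundary _ (flagChain O) =
      ∑ p ∈ (flagsMeeting O).sigma (fun σ => σ), Finsupp.single (p.1.erase p.2) 1 := by
    rw [flagChain, map_sum, Finset.sum_sigma]
    simp only [chainBoundary_single]
  rw [hsum, ← Finset.sum_filter_add_sum_filter_not _ fun p => Disjoint (p.1.erase p.2) O]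
  refine add_eq_left.2 ?_
  choose z hz using exists_flag_reflection hk
  have hz' : ∀ p ∈ ((flagsMeeting O).sigma fun σ => σ).filter fun p => ¬ Disjoint (p.1.erase p.2) O,
      z (p.1.erase p.2) - p.2 ≠ p.2 ∧ z (p.1.erase p.2) - p.2 ∉ p.1.erase p.2 ∧
        IsFlag (insert (z (p.1.erase p.2) - p.2) (p.1.erase p.2)) := by
    rintro ⟨σ, v⟩ hp
    simp only [mem_filter, mem_sigma, mem_flagsMeeting] at hp
    refine hz _ v (Finset.notMem_erase v σ) ?_ ?_ <;> rw [Finset.insert_erase hp.1.2]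
    exacts [hp.1.1.1, hp.1.1.2.1]
  refine Finset.sum_involution
    (fun p _ => ⟨insert (z (p.1.erase p.2) - p.2) (p.1.erase p.2), z (p.1.erase p.2) - p.2⟩)
    ?_ ?_ ?_ ?_
  · rintro ⟨σ, v⟩ hp
    simp only [Finset.erase_insert (hz' _ hp).2.1]
    exact chain_add_self _
  · rintro ⟨σ, v⟩ hp _ h
    exact (hz' _ hp).1 (Sigma.mk.inj_iff.1 h).2.eq
  · rintro ⟨σ, v⟩ hp
    obtain ⟨-, h2, h3⟩ := hz' _ hp
    simp only [mem_filter, mem_sigma, mem_flagsMeeting, Finset.erase_insert h2] at hp ⊢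
    refine ⟨⟨⟨h3, ?_, ?_⟩, Finset.mem_insert_self _ _⟩, hp.2⟩
    · rw [Finset.card_insert_of_notMem h2, Finset.card_erase_of_mem hp.1.2, hp.1.1.2.1,
        Nat.add_sub_cancel]
    · obtain ⟨y, hy, hyO⟩ := Finset.not_disjoint_iff.1 hp.2
      exact ⟨y, Finset.mem_insert_of_mem hy, hyO⟩
  · rintro ⟨σ, v⟩ hp
    simp only [Finset.erase_insert (hz' _ hp).2.1, sub_sub_cancel]
    simp only [mem_filter, mem_sigma] at hp
    rw [Finset.insert_erase hp.1.2]

theorem mem_support_chainBoundary_flagChain (hk : 0 < k) {O : Finset (Fin k → ℤ)}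
    {τ : Finset (Fin k → ℤ)} (hτ : τ ∈ (chainBoundary _ (flagChain O)).support) :
    Disjoint τ O ∧ IsFlag τ ∧ #τ = k ∧ ∀ x ∈ τ, ∃ z ∈ O, IsFace x z ∨ IsFace z x := by
  rw [chainBoundary_flagChain hk, Finsupp.mem_support_iff, Finsupp.finsetSum_apply] at hτ
  obtain ⟨⟨σ, v⟩, hp, hne⟩ := Finset.exists_ne_zero_of_sum_ne_zero hτ
  obtain rfl : σ.erase v = τ := by
    by_contra h
    exact hne (Finsupp.single_eq_of_ne (Ne.symm h))
  simp only [mem_filter, mem_sigma, mem_flagsMeeting] at hp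
  obtain ⟨⟨⟨hflag, hcard, z, hz, hzO⟩, hv⟩, hdisj⟩ := hp
  refine ⟨hdisj, hflag.mono (Finset.erase_subset _ _), ?_, fun x hx => ⟨z, hzO, ?_⟩⟩
  · rw [Finset.card_erase_of_mem hv, hcard, Nat.add_sub_cancel]
  · exact hflag x (Finset.mem_of_mem_erase hx) z hz

theorem image_neg_mem_flagsMeeting {O : Finset (Fin k → ℤ)} (hO : ∀ x ∈ O, -x ∈ O)
    {σ : Finset (Fin k → ℤ)} (hσ : σ ∈ flagsMeeting O) :
    (σ.image fun x => -x) ∈ flagsMeeting O := by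
  rw [mem_flagsMeeting] at hσ ⊢
  obtain ⟨hflag, hcard, z, hz, hzO⟩ := hσ
  exact ⟨hflag.image_neg, by rw [Finset.card_image_of_injective _ neg_injective, hcard],
    -z, Finset.mem_image_of_mem _ hz, hO z hzO⟩

theorem image_neg_image_neg (σ : Finset (Fin k → ℤ)) :
    (σ.image fun x => -x).image (fun x => -x) = σ := by
  rw [Finset.image_image]
  simp

theorem chainMap_neg_flagChain {O : Finset (Fin k → ℤ)} (hO : ∀ x ∈ O, -x ∈ O) :
    chainMap (fun x => -x) (flagChain O) = flagChain O := by
  simp only [flagChain, map_sum, chainMap_single]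
  refine Finset.sum_nbij' (fun σ => σ.image fun x => -x) (fun σ => σ.image fun x => -x)
    (fun σ hσ => image_neg_mem_flagsMeeting hO hσ) (fun σ hσ => image_neg_mem_flagsMeeting hO hσ)
    (fun σ _ => image_neg_image_neg σ) (fun σ _ => image_neg_image_neg σ) (fun σ _ => rfl)

end CubicalGrid

section LocalDegree

variable {k : ℕ}

/-- Whether the first nonzero coordinate of `x` is positive. -/
noncomputable def leadingSign (x : Fin k → ℤ) : Bool :=
  open Classical in decide (∃ i, 0 < x i ∧ ∀ j < i, x j = 0)

theorem leadingSign_eq_true_iff {x : Fin k → ℤ} {i : Fin k} (hi : x i ≠ 0)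
    (hlt : ∀ j < i, x j = 0) : leadingSign x = true ↔ 0 < x i := by
  simp only [leadingSign, decide_eq_true_eq]
  refine ⟨?_, fun h => ⟨i, h, hlt⟩⟩
  rintro ⟨j, hj, hjlt⟩
  rcases lt_trichotomy i j with h | rfl | h
  · exact absurd (hjlt i h) hi
  · exact hj
  · exact absurd (hlt j h) hj.ne'

theorem leadingSign_zero : leadingSign (0 : Fin k → ℤ) = false := by
  simp [leadingSign]

theorem leadingSign_neg {x : Fin k → ℤ} (hx : x ≠ 0) : leadingSign (-x) = !leadingSign x := by
  obtain ⟨i, hi, hmin⟩ := Finset.exists_min_image {i | x i ≠ 0} id (by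
    obtain ⟨i, hi⟩ := Function.ne_iff.1 hx
    exact ⟨i, by simpa using hi⟩)
  simp only [mem_filter, mem_univ, true_and, id] at hi hmin
  have hlt : ∀ j < i, x j = 0 := fun j hj => by
    by_contra h
    exact (hmin j h).not_gt hj
  have h1 := leadingSign_eq_true_iff hi hlt
  have h2 := leadingSign_eq_true_iff (x := -x) (i := i) (by simpa using hi)
    fun j hj => by simp [hlt j hj]
  rw [Pi.neg_apply] at h2
  rw [Bool.eq_iff_iff, h2, Bool.not_eq_true', ← Bool.not_eq_true, h1]
  omega

theorem card_filter_le_val {j : ℕ} (hj : j ≤ k) : #{i : Fin k | j ≤ (i : ℕ)} + j = k := by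
  have h := Finset.card_filter_add_card_filter_not (s := (univ : Finset (Fin k)))
    fun i => (i : ℕ) < j
  simp only [not_lt, Fin.card_filter_val_lt, card_univ, Fintype.card_fin] at h
  omega

theorem odd_of_cellDim_add_eq {x : Fin k → ℤ} {j : ℕ} (hd : cellDim x + j = k)
    (hx : ∀ i : Fin k, (i : ℕ) < j → x i = 0) {i : Fin k} (hi : j ≤ (i : ℕ)) : Odd (x i) := by
  have hsub : ({i | Odd (x i)} : Finset (Fin k)) ⊆ ({i | j ≤ (i : ℕ)} : Finset (Fin k)) := by
    intro i hi
    simp only [mem_filter, mem_univ, true_and] at hi ⊢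
    by_contra! h
    simp [hx i h] at hi
  have heq := Finset.eq_of_subset_of_card_le hsub (by
    have := card_filter_le_val (k := k) (j := j) (by omega)
    unfold cellDim at hd
    omega)
  have : i ∈ ({i | Odd (x i)} : Finset (Fin k)) := by rw [heq]; simpa using hi
  simpa using this

/-- The cell whose last `j` coordinates are alternately `1` and `-1`, the last one being `1`, and
whose other coordinates vanish. -/
def stairCell (k j : ℕ) (i : Fin k) : ℤ := if i + j < k then 0 else (-1) ^ ((i : ℕ) + k + 1)

theorem cellDim_stairCell {j : ℕ} (hj : j ≤ k) : cellDim (stairCell k j) = j := by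
  have h : cellDim (stairCell k j) = #{i : Fin k | k - j ≤ (i : ℕ)} := by
    refine congrArg Finset.card (Finset.filter_congr fun i _ => ?_)
    unfold stairCell
    split_ifs with h
    · simp only [Int.not_odd_zero, false_iff]
      omega
    · have : Odd ((-1 : ℤ) ^ ((i : ℕ) + k + 1)) := Odd.pow (by decide)
      simp only [this, true_iff]
      omega
  have := card_filter_le_val (k := k) (j := k - j) (by omega)
  omega

theorem isFace_stairCell {i j : ℕ} (hij : i ≤ j) : IsFace (stairCell k i) (stairCell k j) := by
  intro l
  simp only [stairCell]
  split_ifs with h1 h2 h2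
  · exact Or.inl rfl
  · rcases neg_one_pow_eq_or ℤ ((l : ℕ) + k + 1) with h | h <;> simp [h]
  · omega
  · exact Or.inl rfl

theorem leadingSign_stairCell {j : ℕ} (hj : j ≤ k) :
    leadingSign (stairCell k j) = false ↔ Even j := by
  rcases Nat.eq_zero_or_pos j with rfl | hpos
  · have : stairCell k 0 = 0 := by
      ext i
      simp [stairCell]
    simp [this, leadingSign_zero]
  · have hval : stairCell k j ⟨k - j, by omega⟩ = (-1) ^ (j + 1) := by
      have h1 : ¬ (k - j + j < k) := by omega
      simp only [stairCell, h1, if_false]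
      rw [neg_one_pow_eq_pow_mod_two, neg_one_pow_eq_pow_mod_two (n := j + 1)]
      congr 1
      omega
    have h := leadingSign_eq_true_iff (x := stairCell k j) (i := ⟨k - j, by omega⟩)
      (by rw [hval]; exact pow_ne_zero _ (by norm_num)) fun i hi => by
        have : (i : ℕ) + j < k := by
          have : (i : ℕ) < k - j := hi
          omega
        simp [stairCell, this]
    rw [← Bool.not_eq_true, h, hval]
    rcases Nat.even_or_odd j with he | ho
    · simp [he, he.add_one.neg_one_pow]
    · simp [Nat.not_even_iff_odd.2 ho, ho.add_one.neg_one_pow]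

/-- The flag of all staircase cells. -/
def stairFlag (k : ℕ) : Finset (Fin k → ℤ) := (Finset.range (k + 1)).image (stairCell k)

theorem isFlag_stairFlag : IsFlag (stairFlag k) := by
  unfold IsFlag stairFlag
  simp only [Finset.forall_mem_image]
  exact fun i _ j _ => (le_total i j).imp isFace_stairCell isFace_stairCell

theorem card_stairFlag : #(stairFlag k) = k + 1 := by
  rw [stairFlag, Finset.card_image_of_injOn, Finset.card_range]
  intro i hi j hj hij
  simp only [coe_range, Set.mem_Iio] at hi hj
  rw [← cellDim_stairCell (k := k) (j := i) (by omega), hij, cellDim_stairCell (by omega)]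

theorem zero_mem_stairFlag : (0 : Fin k → ℤ) ∈ stairFlag k :=
  Finset.mem_image.2 ⟨0, by simp, by ext i; simp [stairCell]⟩

theorem isAlternating_stairFlag : IsAlternating cellDim leadingSign false (stairFlag k) := by
  intro v hv
  rw [isFlag_stairFlag.card_filter_cellDim_lt card_stairFlag]
  obtain ⟨j, hj, rfl⟩ := Finset.mem_image.1 hv
  have hj' : j ≤ k := by simpa [Nat.lt_succ_iff] using hj
  rw [leadingSign_stairCell hj', cellDim_stairCell hj']

/-- The staircase flag is the only alternating maximal flag at the origin. -/
theorem eq_stairFlag_of_isAlternating {σ : Finset (Fin k → ℤ)} (hσ : IsFlag σ)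
    (hcard : #σ = k + 1) (h0 : 0 ∈ σ) (halt : IsAlternating cellDim leadingSign false σ) :
    σ = stairFlag k := by
  have hsign : ∀ x ∈ σ, (leadingSign x = false ↔ Even (cellDim x)) := fun x hx => by
    rw [halt x hx, hσ.card_filter_cellDim_lt hcard]
  have hunit : ∀ x ∈ σ, ∀ i, x i = 0 ∨ x i = 1 ∨ x i = -1 := fun x hx i => by
    have := hσ.isFace h0 hx (by simp [cellDim_zero]) i
    simp only [Pi.zero_apply] at this
    omega
  have hzero : ∀ j : ℕ, ∀ x ∈ σ, cellDim x + j = k → ∀ i : Fin k, (i : ℕ) < j → x i = 0 := by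
    intro j
    induction j with
    | zero => exact fun x _ _ i hi => absurd hi (Nat.not_lt_zero _)
    | succ j ih =>
      intro x hx hxd i hi
      obtain ⟨y, hy, hyd⟩ := hσ.exists_cellDim_eq hcard (d := cellDim x + 1) (by omega)
      have hface : IsFace x y := hσ.isFace hx hy (by omega)
      have hyzero := ih y hy (by omega)
      have hxzero : ∀ l : Fin k, (l : ℕ) < j → x l = 0 := fun l hl => by
        have := hface l
        simpa [hyzero l hl] using this
      rcases Nat.lt_succ_iff_lt_or_eq.1 hi with hlt | hij
      · exact hxzero i hlt
      by_contra hne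
      have hyodd : Odd (y i) := odd_of_cellDim_add_eq (by omega) hyzero hij.ge
      have hxy : x i = y i := by
        have h1 := hface i
        have h2 := hunit x hx i
        have h3 := hunit y hy i
        simp only [Int.odd_iff] at h1
        omega
      have hsx := leadingSign_eq_true_iff hne fun l hl => hxzero l (hij ▸ hl)
      have hsy := leadingSign_eq_true_iff (hxy ▸ hne) fun l hl => hyzero l (hij ▸ hl)
      have hxp := hsign x hx
      have hyp := hsign y hy
      rw [hyd, Nat.even_add_one] at hyp
      rw [← Bool.not_eq_true, hsx, hxy] at hxp
      rw [← Bool.not_eq_true, hsy] at hyp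
      tauto
  refine Finset.eq_of_subset_of_card_le (fun x hx => ?_) (by rw [card_stairFlag, hcard])
  refine Finset.mem_image.2
    ⟨cellDim x, Finset.mem_range.2 (Nat.lt_succ_of_le (cellDim_le x)), ?_⟩
  ext i
  have hxk := cellDim_le x
  simp only [stairCell]
  split_ifs with hi
  · exact (hzero (k - cellDim x) x hx (by omega) i (by omega)).symm
  · obtain ⟨y, hy, hyd⟩ := hσ.exists_cellDim_eq hcard (d := k - i) (by omega)
    have hyzero := hzero i y hy (by omega)
    have hyodd : Odd (y i) := odd_of_cellDim_add_eq (by omega) hyzero le_rfl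
    have hyx : y i = x i := by
      have h1 := hσ.isFace hy hx (by omega) i
      have h2 := hunit x hx i
      have h3 := hunit y hy i
      simp only [Int.odd_iff] at h1 hyodd
      omega
    have hne : y i ≠ 0 := by
      intro h
      simp [h] at hyodd
    have hs := leadingSign_eq_true_iff hne fun l hl => hyzero l hl
    have hp := hsign y hy
    rw [← Bool.not_eq_true, hs, hyd, hyx] at hp
    rw [hyx] at hne
    have hxu := hunit x hx i
    have hpar : Even ((i : ℕ) + k + 1) ↔ ¬ Even (k - i) := by
      simp only [Nat.even_iff]
      omega
    rcases Nat.even_or_odd ((i : ℕ) + k + 1) with he | ho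
    · rw [he.neg_one_pow]
      have : 0 < x i := by
        by_contra h
        exact hpar.1 he (hp.1 h)
      omega
    · rw [ho.neg_one_pow]
      have : Even (k - i) := by
        by_contra h
        exact Nat.not_even_iff_odd.2 ho (hpar.2 h)
      have := hp.2 this
      omega

theorem chainEval_flagChain (θ : Finset (Fin k → ℤ) → ZMod 2) (O : Finset (Fin k → ℤ)) :
    chainEval θ (flagChain O) = ∑ σ ∈ flagsMeeting O, θ σ := by
  simp only [flagChain, map_sum, chainEval_single]

/-- The boundary of a symmetric neighbourhood of the origin has odd index. -/
theorem chainEval_chainBoundary_flagChain {O : Finset (Fin k → ℤ)} (hO : ∀ x ∈ O, -x ∈ O)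
    (h0 : 0 ∈ O) :
    chainEval (alternatingCochain cellDim leadingSign false) (chainBoundary _ (flagChain O))
      = 1 := by
  rw [chainEval_chainBoundary, chainEval_flagChain,
    Finset.sum_congr rfl fun σ hσ => sum_alternatingCochain_erase false
      (mem_flagsMeeting.1 hσ).1.injOn_cellDim,
    ← Finset.sum_filter_add_sum_filter_not _ fun σ => (0 : Fin k → ℤ) ∈ σ]
  have haway : ∑ σ ∈ flagsMeeting O with (0 : Fin k → ℤ) ∉ σ,
      (alternatingCochain cellDim leadingSign false σ +
        alternatingCochain cellDim leadingSign (!false) σ) = 0 := by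
    rw [Finset.sum_add_distrib]
    have hswap : ∑ σ ∈ flagsMeeting O with (0 : Fin k → ℤ) ∉ σ,
        alternatingCochain cellDim leadingSign (!false) σ =
        ∑ σ ∈ flagsMeeting O with (0 : Fin k → ℤ) ∉ σ,
          alternatingCochain cellDim leadingSign false σ := by
      have hmaps : ∀ σ ∈ (flagsMeeting O).filter fun σ => (0 : Fin k → ℤ) ∉ σ,
          (σ.image fun x => -x) ∈ (flagsMeeting O).filter fun σ => (0 : Fin k → ℤ) ∉ σ := by
        intro σ hσ
        simp only [mem_filter] at hσ ⊢
        exact ⟨image_neg_mem_flagsMeeting hO hσ.1, by simpa using hσ.2⟩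
      refine Finset.sum_nbij' (fun σ => σ.image fun x => -x) (fun σ => σ.image fun x => -x)
        hmaps hmaps (fun σ _ => image_neg_image_neg σ) (fun σ _ => image_neg_image_neg σ) ?_
      intro σ hσ
      refine (alternatingCochain_image neg_injective (fun v _ => cellDim_neg v) ?_ false).symm
      rintro v hv
      refine leadingSign_neg ?_
      rintro rfl
      exact (Finset.mem_filter.1 hσ).2 hv
    rw [hswap, CharTwo.add_self_eq_zero]
  rw [haway, add_zero, Finset.sum_eq_single (stairFlag k)]
  · have h1 : ¬ IsAlternating cellDim leadingSign true (stairFlag k) := fun h => by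
      have := h 0 zero_mem_stairFlag
      simp [leadingSign_zero, cellDim_zero] at this
    simp [alternatingCochain, isAlternating_stairFlag, h1]
  · intro σ hσ hne
    simp only [mem_filter, mem_flagsMeeting] at hσ
    have h1 : ¬ IsAlternating cellDim leadingSign true σ := fun h => by
      have := h 0 hσ.2
      simp [leadingSign_zero, cellDim_zero] at this
    have h2 : ¬ IsAlternating cellDim leadingSign false σ := fun h =>
      hne (eq_stairFlag_of_isAlternating hσ.1.1 hσ.1.2.1 hσ.2 h)
    simp [alternatingCochain, h1, h2]
  · intro h
    exact absurd (Finset.mem_filter.2 ⟨mem_flagsMeeting.2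
      ⟨isFlag_stairFlag, card_stairFlag, 0, zero_mem_stairFlag, h0⟩, zero_mem_stairFlag⟩) h

/-- A combinatorial Borsuk-Ulam theorem: there is no antipodal labelling by fewer than `k` labels
of the cells around the boundary of a symmetric neighbourhood of the origin such that incident
cells with equal labels have equal signs. -/
theorem not_exists_antipodal_labelling {m : ℕ} (hmk : m < k) {O : Finset (Fin k → ℤ)}
    (hO : ∀ x ∈ O, -x ∈ O) (h0 : 0 ∈ O) (ℓ : (Fin k → ℤ) → ℕ) (s : (Fin k → ℤ) → Bool)
    {U : Set (Fin k → ℤ)} (hU : ∀ x ∉ O, ∀ z ∈ O, IsFace x z ∨ IsFace z x → x ∈ U)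
    (hℓm : ∀ x ∈ U, ℓ x < m) (hℓ : ∀ x ∈ U, ℓ (-x) = ℓ x) (hs : ∀ x ∈ U, s (-x) = !s x)
    (hcompl : ∀ x ∈ U, ∀ y ∈ U, IsFace x y → ℓ x = ℓ y → s x = s y) : False := by
  have hk : 0 < k := by omega
  set C := chainBoundary _ (flagChain O) with hC
  set r : (Fin k → ℤ) → ℕ := fun x => ℓ x * (k + 1) + cellDim x with hr
  have hℓr : ∀ x y, r x ≤ r y → ℓ x ≤ ℓ y := by
    intro x y hxy
    by_contra! hlt
    have h1 : (ℓ y + 1) * (k + 1) ≤ ℓ x * (k + 1) := Nat.mul_le_mul_right _ hlt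
    have h2 := cellDim_le y
    simp only [hr] at hxy
    rw [add_mul, one_mul] at h1
    omega
  have hrinj : ∀ τ ∈ C.support, Set.InjOn r τ := by
    intro τ hτ x hx y hy hxy
    have h1 : ℓ x = ℓ y := le_antisymm (hℓr x y hxy.le) (hℓr y x hxy.ge)
    refine (mem_support_chainBoundary_flagChain hk hτ).2.1.injOn_cellDim hx hy ?_
    simpa [hr, h1] using hxy
  have hCU : ∀ τ ∈ C.support, ∀ x ∈ τ, x ∈ U ∧ x ≠ 0 := by
    intro τ hτ x hx
    obtain ⟨hdisj, -, -, hnear⟩ := mem_support_chainBoundary_flagChain hk hτ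
    have hxO : x ∉ O := Finset.disjoint_left.1 hdisj hx
    obtain ⟨z, hz, hxz⟩ := hnear x hx
    exact ⟨hU x hxO z hz hxz, by rintro rfl; exact hxO h0⟩
  have heq := chainEval_alternatingCochain_eq (a := fun x : Fin k → ℤ => -x)
    (U := {x | x ∈ U ∧ x ≠ 0}) (r := cellDim) (r' := r) (s := leadingSign) (s' := s) neg_involutive
    (fun v _ => cellDim_neg v) (fun v hv => leadingSign_neg hv.2)
    (fun v hv => by simp only [hr, cellDim_neg, hℓ v hv.1]) (fun v hv => hs v hv.1) k false C
    (fun τ hτ => (mem_support_chainBoundary_flagChain hk hτ).2.2.1) hCU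
    (fun τ hτ => (mem_support_chainBoundary_flagChain hk hτ).2.1.injOn_cellDim) hrinj
    (by rw [hC, ← chainBoundary_chainMap neg_injective, chainMap_neg_flagChain hO])
    (chainBoundary_chainBoundary _)
  rw [hC, chainEval_chainBoundary_flagChain hO h0, ← hC,
    chainEval_congr (η := fun _ => 0) (c := C)] at heq
  · simp [chainEval, Finsupp.linearCombination_apply] at heq
  · intro τ hτ
    refine if_neg fun halt => ?_
    obtain ⟨-, hflag, hcard, -⟩ := mem_support_chainBoundary_flagChain hk hτ
    have hinj : Set.InjOn ℓ τ := halt.injOn_label (hrinj τ hτ) (fun v _ w _ => hℓr v w) <| by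
      intro v hv w hw hvw
      rcases hflag v hv w hw with h | h
      · exact hcompl v (hCU τ hτ v hv).1 w (hCU τ hτ w hw).1 h hvw
      · exact (hcompl w (hCU τ hτ w hw).1 v (hCU τ hτ v hv).1 h hvw.symm).symm
    have hle : #τ ≤ #(Finset.range m) := Finset.card_le_card_of_injOn ℓ
      (fun v hv => by simpa using hℓm v (hCU τ hτ v hv).1) hinj
    rw [hcard, Finset.card_range] at hle
    omega

end LocalDegree

/-- A Borsuk-Ulam theorem for boundaries of bounded symmetric neighbourhoods of the origin: an odd
map to a space of smaller dimension has a zero on the zero set of an even function that is negative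
at the origin and nonnegative outside a bounded set. -/
theorem exists_zero_of_odd_of_even {k m : ℕ} (hmk : m < k) {g : (Fin k → ℝ) → (Fin m → ℝ)}
    {φ : (Fin k → ℝ) → ℝ} (hg : Continuous g) (hφ : Continuous φ) (hgodd : ∀ u, g (-u) = -g u)
    (hφeven : ∀ u, φ (-u) = φ u) (hφ0 : φ 0 < 0) {M : ℝ} (hM : ∀ u, φ u < 0 → ‖u‖ ≤ M) :
    ∃ u, g u = 0 ∧ φ u = 0 := by
  by_contra! hno
  have hM0 : 0 ≤ M := by simpa using hM 0 hφ0
  set B : Set (Fin k → ℝ) := Metric.closedBall 0 (M + 1) with hB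
  have hBc : IsCompact B := isCompact_closedBall 0 (M + 1)
  obtain ⟨δ, hδ, hδB⟩ : ∃ δ > 0, ∀ u ∈ B, δ ≤ max ‖g u‖ |φ u| := by
    obtain ⟨u, -, hu⟩ := hBc.exists_isMinOn (f := fun u => max ‖g u‖ |φ u|)
      ⟨0, Metric.mem_closedBall_self (by linarith)⟩ (by fun_prop)
    refine ⟨max ‖g u‖ |φ u|, ?_, hu⟩
    by_cases h : g u = 0
    · exact lt_max_of_lt_right (abs_pos.2 (hno u h))
    · exact lt_max_of_lt_left (norm_pos_iff.2 h)
  obtain ⟨ε, hε, hεB⟩ := Metric.uniformContinuousOn_iff.1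
    (hBc.uniformContinuousOn_of_continuous (hg.prodMk hφ).continuousOn) δ hδ
  obtain ⟨t, ht, htε, ht1⟩ : ∃ t > 0, t < ε ∧ t ≤ 1 :=
    ⟨min (ε / 2) 1, by positivity, (min_le_left _ _).trans_lt (by linarith), min_le_right _ _⟩
  -- The geometric realization of the grid with mesh size `t`.
  set P : (Fin k → ℤ) → (Fin k → ℝ) := fun x i => t * x i with hP
  have hPneg : ∀ x, P (-x) = -P x := fun x => by
    ext i
    simp [hP]
  have hPdist : ∀ x y, IsFace x y → dist (P x) (P y) ≤ t := by
    intro x y hxy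
    refine (dist_pi_le_iff ht.le).2 fun i => ?_
    have h1 : |((x i : ℤ) : ℝ) - y i| ≤ 1 := by exact_mod_cast hxy.abs_sub_le i
    rw [Real.dist_eq, hP, ← mul_sub, abs_mul, abs_of_pos ht]
    exact mul_le_of_le_one_right ht.le h1
  obtain ⟨N, hN⟩ := exists_nat_ge (M / t)
  set O : Finset (Fin k → ℤ) :=
    {x ∈ Finset.Icc (fun _ => -(N : ℤ)) (fun _ => (N : ℤ)) | φ (P x) < 0} with hOdef
  have hmemO : ∀ x, x ∈ O ↔ φ (P x) < 0 := by
    intro x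
    simp only [hOdef, mem_filter, and_iff_right_iff_imp, Finset.mem_Icc]
    intro hx
    have h1 : ∀ i, |x i| ≤ (N : ℤ) := fun i => by
      have h2 : t * |(x i : ℝ)| ≤ M := by
        have := (norm_le_pi_norm (P x) i).trans (hM _ hx)
        rwa [hP, Real.norm_eq_abs, abs_mul, abs_of_pos ht] at this
      have h3 : |(x i : ℝ)| ≤ N := ((le_div_iff₀' ht).2 h2).trans hN
      exact_mod_cast h3
    exact ⟨fun i => (abs_le.1 (h1 i)).1, fun i => (abs_le.1 (h1 i)).2⟩
  set U : Set (Fin k → ℤ) := {x | P x ∈ B ∧ |φ (P x)| < δ}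
  set L : (Fin k → ℤ) → Set ℕ := fun x => {n | ∃ h : n < m, δ ≤ |g (P x) ⟨n, h⟩|} with hL
  have hLneg : ∀ x, L (-x) = L x := fun x => by simp [hL, hPneg, hgodd]
  have hLmem : ∀ x ∈ U, sInf (L x) ∈ L x := by
    rintro x ⟨hxB, hxφ⟩
    refine Nat.sInf_mem ?_
    by_contra hempty
    have hlt : ∀ i, ‖g (P x) i‖ < δ := fun i => by
      by_contra! h
      exact hempty ⟨i, i.2, h⟩
    exact (hδB _ hxB).not_gt (max_lt ((pi_norm_lt_iff hδ).2 hlt) hxφ)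
  classical
  refine not_exists_antipodal_labelling hmk (O := O) (fun x hx => ?_) ?_ (fun x => sInf (L x))
    (fun x => decide (∃ h : sInf (L x) < m, 0 < g (P x) ⟨sInf (L x), h⟩)) (U := U) ?_
    (fun x hx => (hLmem x hx).1) (fun x _ => by simp only [hLneg]) ?_ ?_
  · rw [hmemO] at hx ⊢
    rwa [hPneg, hφeven]
  · have : P 0 = 0 := by
      ext i
      simp [hP]
    rwa [hmemO, this]
  · intro x hx z hz hxz
    rw [hmemO] at hx hz
    have hdist : dist (P x) (P z) ≤ t := by
      rcases hxz with h | h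
      · exact hPdist x z h
      · rw [dist_comm]
        exact hPdist z x h
    have hzM := hM _ hz
    have hzB : P z ∈ B := by
      rw [hB, mem_closedBall_zero_iff]
      linarith
    have hxB : P x ∈ B := by
      have h1 := dist_triangle (P x) (P z) 0
      rw [hB, Metric.mem_closedBall]
      rw [dist_zero_right (P z)] at h1
      linarith
    have h2 := (le_max_right _ _).trans_lt (hεB _ hxB _ hzB (hdist.trans_lt htε))
    rw [Real.dist_eq] at h2
    refine ⟨hxB, ?_⟩
    rw [abs_of_nonneg (not_lt.1 hx)]
    have := (abs_lt.1 h2).2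
    simp only at this
    linarith
  · intro x hx
    obtain ⟨h1, h2⟩ := hLmem x hx
    simp only [hLneg, hPneg, hgodd, Pi.neg_apply, h1, exists_true_left]
    rw [← decide_not, decide_eq_decide, Left.neg_pos_iff, not_lt]
    refine ⟨le_of_lt, fun h => lt_of_le_of_ne h fun h3 => ?_⟩
    rw [h3, abs_zero] at h2
    linarith
  · intro x hx y hy hxy hℓ
    obtain ⟨h1, h2⟩ := hLmem x hx
    obtain ⟨h3, h4⟩ := hLmem y hy
    have h5 := (le_max_left _ _).trans_lt (hεB _ hx.1 _ hy.1 ((hPdist x y hxy).trans_lt htε))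
    have h6 := (dist_le_pi_dist _ _ ⟨sInf (L x), h1⟩).trans_lt h5
    rw [Real.dist_eq] at h6
    simp only [← hℓ, h1, exists_true_left] at h4 h6 ⊢
    rw [decide_eq_decide]
    rw [abs_lt] at h6
    rcases le_abs.1 h2 with h | h <;> rcases le_abs.1 h4 with h' | h' <;> constructor <;> intro <;>
      linarith [h6.1, h6.2]

end BorsukUlam

/-- Intersection lemma: if `h : D_k → X` is continuous, odd, and equals the identity on
`∂B_{R_k} ∩ Y^k`, where `Y^k` is a `k`-dimensional subspace, and `Y` is a closed subspace of
codimension `< k`, then for every `0 < R < R_k`, `h(D_k) ∩ ∂B_R ∩ Y ≠ ∅`. -/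
theorem image_inter_sphere_inter_subspace_nonempty {X : Type*} [NormedAddCommGroup X]
    [NormedSpace ℝ X] [CompleteSpace X]
    (k : ℕ) (Yk : Subspace ℝ X) [FiniteDimensional ℝ Yk] (hdim : Module.finrank ℝ Yk = k)
    (Rk : ℝ) (hRk : 0 < Rk)
    (h : X → X)
    (hcont : ContinuousOn h {u : X | u ∈ Yk ∧ ‖u‖ ≤ Rk})
    (hodd : ∀ u : X, u ∈ Yk → ‖u‖ ≤ Rk → h (-u) = -h u)
    (hid : ∀ u : X, u ∈ Yk → ‖u‖ = Rk → h u = u)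
    (Y : Subspace ℝ X) (hYclosed : IsClosed (Y : Set X))
    (hfd : FiniteDimensional ℝ (X ⧸ Y)) (hcodim : Module.finrank ℝ (X ⧸ Y) < k) :
    ∀ R : ℝ, 0 < R → R < Rk →
      ∃ u : X, u ∈ Yk ∧ ‖u‖ ≤ Rk ∧ h u ∈ Y ∧ ‖h u‖ = R := by
  intro R hR hRRk
  obtain ⟨e⟩ : Nonempty ((Fin k → ℝ) ≃L[ℝ] Yk) :=
    FiniteDimensional.nonempty_continuousLinearEquiv_of_finrank_eq (by simp [hdim])
  obtain ⟨q⟩ : Nonempty ((X ⧸ Y) ≃L[ℝ] (Fin (Module.finrank ℝ (X ⧸ Y)) → ℝ)) :=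
    FiniteDimensional.nonempty_continuousLinearEquiv_of_finrank_eq (by simp)
  -- Extend `h` by the identity outside the ball of radius `Rk`.
  set H : Yk → X := fun u => if ‖(u : X)‖ ≤ Rk then h u else u with hH
  have hHcont : Continuous H := by
    refine continuous_if_le (by fun_prop) continuous_const ?_ (by fun_prop)
      fun u hu => hid u u.2 hu
    exact hcont.comp continuous_subtype_val.continuousOn fun u hu => ⟨u.2, hu⟩
  have hHodd : ∀ u, H (-u) = -H u := by
    intro u
    simp only [hH, Submodule.coe_neg, norm_neg]
    split_ifs with hu
    · exact hodd u u.2 hu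
    · rfl
  have hHbound : ∀ u, ‖H u‖ < Rk → ‖(u : X)‖ ≤ Rk := by
    intro u hu
    by_contra hlt
    simp only [hH, hlt, if_false] at hu
    exact hlt hu.le
  have hH0 : H 0 = 0 := by
    have h0 := hHodd 0
    rw [neg_zero] at h0
    have h2 : (2 : ℝ) • H 0 = 0 := by rw [two_smul, ← eq_neg_iff_add_eq_zero, ← h0]
    exact (smul_eq_zero.1 h2).resolve_left two_ne_zero
  obtain ⟨c, hcY, hcR⟩ := exists_zero_of_odd_of_even hcodim
    (g := fun c => q (Y.mkQ (H (e c)))) (φ := fun c => ‖H (e c)‖ - R)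
    (q.continuous.comp (continuous_quot_mk.comp (hHcont.comp e.continuous)))
    (by fun_prop) (fun c => by simp only [map_neg, hHodd])
    (fun c => by simp only [map_neg, hHodd, norm_neg])
    (by simp [hH0, hR]) (M := ‖(e.symm : Yk →L[ℝ] (Fin k → ℝ))‖ * Rk) fun c hc => by
      have h1 : ‖e c‖ ≤ Rk := hHbound _ (by linarith)
      calc ‖c‖ = ‖(e.symm : Yk →L[ℝ] (Fin k → ℝ)) (e c)‖ := by simp
        _ ≤ _ := ContinuousLinearMap.le_opNorm_of_le _ h1
  have hR' : ‖H (e c)‖ = R := sub_eq_zero.1 hcR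
  have hball : ‖(e c : X)‖ ≤ Rk := hHbound _ (by rw [hR']; exact hRRk)
  have hHh : H (e c) = h (e c) := if_pos hball
  refine ⟨e c, (e c).2, hball, ?_, by rw [← hHh, hR']⟩
  rw [← hHh, ← Submodule.ker_mkQ Y, LinearMap.mem_ker]
  simpa using hcY
end

section
/- Let X be a real Banach space and I ∈ C¹(X, ℝ) an even functional satisfying the Palais–Smale condition. Let k ∈ ℕ, let Y^k be a k-dimensional linear subspace of X and R_k > 0 such that I(u) < 0 for every u ∈ Y^k with ‖u‖ ≥ R_k. Set D_k = {u ∈ Y^k : ‖u‖ ≤ R_k}, let G_k be the set of continuous maps h : D_k → X that are odd (h(−u) = −h(u)) and satisfy h(u) = u for all u ∈ Y^k with ‖u‖ = R_k, and define the minimax value c_k = inf_{h ∈ G_k} max_{u ∈ D_k} I(h(u)). If c_k > 0, then c_k is a critical value of I, i.e. there exists v ∈ X with I′(v) = 0 and I(v) = c_k. -/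
open Filter

/-- The Palais–Smale condition for a `C¹` functional on a Banach space. -/
def PalaisSmale {X : Type*} [NormedAddCommGroup X] [NormedSpace ℝ X] (I : X → ℝ) : Prop :=
  ∀ u : ℕ → X, (∃ C : ℝ, ∀ n, |I (u n)| ≤ C) →
    Tendsto (fun n => ‖fderiv ℝ I (u n)‖) atTop (nhds 0) →
    ∃ v : X, ∃ φ : ℕ → ℕ, StrictMono φ ∧ Tendsto (u ∘ φ) atTop (nhds v)

/-- The symmetric mountain pass minimax value
`c = inf_{h ∈ G} max_{u ∈ D} I(h(u))`, where `D = {u ∈ Yk : ‖u‖ ≤ R}` and `G` is the set of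
continuous odd maps `h : D → X` with `h = id` on `{u ∈ Yk : ‖u‖ = R}`. -/
noncomputable def minimax {X : Type*} [NormedAddCommGroup X] [NormedSpace ℝ X]
    (I : X → ℝ) (Yk : Submodule ℝ X) (R : ℝ) : ℝ :=
  sInf {r : ℝ | ∃ h : X → X,
    ContinuousOn h {u : X | u ∈ Yk ∧ ‖u‖ ≤ R} ∧
    (∀ u : X, u ∈ Yk → ‖u‖ ≤ R → h (-u) = -h u) ∧
    (∀ u : X, u ∈ Yk → ‖u‖ = R → h u = u) ∧
    r = sSup ((fun u => I (h u)) '' {u : X | u ∈ Yk ∧ ‖u‖ ≤ R})}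

open Topology Set

/-- A weak form of Ekeland's variational principle. -/
theorem exists_le_forall_le_add_mul_dist {M : Type*} [MetricSpace M] [CompleteSpace M]
    {f : M → ℝ} (hf : Continuous f) (hbdd : BddBelow (range f)) {ε : ℝ} (hε : 0 < ε) (x₀ : M) :
    ∃ x, f x ≤ f x₀ ∧ ∀ y, f x ≤ f y + ε * dist x y := by
  obtain ⟨b, hb⟩ := hbdd
  have hb' : ∀ x, b ≤ f x := fun x => hb ⟨x, rfl⟩
  have step : ∀ (n : ℕ) (x : M), ∃ y, f y + ε * dist x y ≤ f x ∧
      ∀ z, f z + ε * dist x z ≤ f x → f y ≤ f z + (1 / 2 : ℝ) ^ n := by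
    intro n x
    have hne : (f '' {y | f y + ε * dist x y ≤ f x}).Nonempty := ⟨f x, x, by simp, rfl⟩
    have hbelow : BddBelow (f '' {y | f y + ε * dist x y ≤ f x}) :=
      ⟨b, by rintro _ ⟨y, -, rfl⟩; exact hb' y⟩
    obtain ⟨_, ⟨y, hy, rfl⟩, hlt⟩ := exists_lt_of_csInf_lt hne
      (lt_add_of_pos_right _ (by positivity : (0 : ℝ) < (1 / 2) ^ n))
    refine ⟨y, hy, fun z hz => hlt.le.trans ?_⟩
    gcongr
    exact csInf_le hbelow ⟨z, hz, rfl⟩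
  choose next hnext hmin using step
  let x : ℕ → M := fun n => Nat.rec x₀ next n
  have hx : ∀ n, x (n + 1) = next n (x n) := fun n => rfl
  have hchain : ∀ n m, n ≤ m → f (x m) + ε * dist (x n) (x m) ≤ f (x n) := by
    intro n m hnm
    induction m, hnm using Nat.le_induction with
    | base => simp
    | succ m _ ih =>
      have h1 := hnext m (x m)
      rw [← hx] at h1
      have h2 := mul_le_mul_of_nonneg_left (dist_triangle (x n) (x m) (x (m + 1))) hε.le
      linarith
  have hanti : Antitone (f ∘ x) := fun n m hnm => by
    have := hchain n m hnm
    have : 0 ≤ ε * dist (x n) (x m) := by positivity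
    simp only [Function.comp_apply]
    linarith
  have hlim := tendsto_atTop_ciInf hanti ⟨b, by rintro _ ⟨n, rfl⟩; exact hb' _⟩
  set l := ⨅ n, (f ∘ x) n
  have hl : ∀ n, l ≤ f (x n) := fun n => hanti.le_of_tendsto hlim n
  have hcauchy : CauchySeq x := by
    refine cauchySeq_of_le_tendsto_0' (fun n => (f (x n) - l) / ε) (fun n m hnm => ?_) ?_
    · rw [le_div_iff₀ hε]
      have := hchain n m hnm
      have := hl m
      linarith
    · simpa using (hlim.sub_const l).div_const ε
  obtain ⟨a, ha⟩ := cauchySeq_tendsto_of_complete hcauchy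
  have hfa : Tendsto (fun n => f (x n)) atTop (𝓝 (f a)) := (hf.tendsto a).comp ha
  have hmem : ∀ n, f a + ε * dist (x n) a ≤ f (x n) := fun n =>
    le_of_tendsto (hfa.add ((tendsto_const_nhds.dist ha).const_mul ε))
      (eventually_atTop.2 ⟨n, hchain n⟩)
  refine ⟨a, ?_, fun y => ?_⟩
  · have := hmem 0
    have : 0 ≤ ε * dist (x 0) a := by positivity
    change f a ≤ f (x 0)
    linarith
  · by_contra! hlt
    have hle : ∀ n, f (x (n + 1)) ≤ f y + (1 / 2 : ℝ) ^ n := fun n => by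
      rw [hx]
      refine hmin n (x n) y ?_
      have h1 := mul_le_mul_of_nonneg_left (dist_triangle (x n) a y) hε.le
      have h2 := hmem n
      linarith
    have hfy : f a ≤ f y + 0 := le_of_tendsto_of_tendsto'
      (hfa.comp (tendsto_add_atTop_nat 1))
      (tendsto_const_nhds.add
        (tendsto_pow_atTop_nhds_zero_of_lt_one (by norm_num) (by norm_num))) hle
    have : 0 ≤ ε * dist a y := by positivity
    linarith

/-- If moving `h` in the direction `-w` decreases `max I ∘ h` at rate at most `ε`, then
`I' (h u) (w u) ≤ ε` at some maximum point `u` of `I ∘ h`. -/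
theorem exists_isMax_fderiv_apply_le {X D : Type*} [NormedAddCommGroup X] [NormedSpace ℝ X]
    [MetricSpace D] [CompactSpace D] [Nonempty D] {I : X → ℝ} (hI : ContDiff ℝ 1 I)
    (h w : C(D, X)) {ε : ℝ}
    (hmin : ∀ s : ℝ, 0 < s →
      sSup ((fun u => I (h u)) '' univ) ≤ sSup ((fun u => I ((h - s • w) u)) '' univ) + ε * s) :
    ∃ u, I (h u) = sSup ((fun u => I (h u)) '' univ) ∧ fderiv ℝ I (h u) (w u) ≤ ε := by
  set m := sSup ((fun u => I (h u)) '' univ)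
  have hm : ∀ u, I (h u) ≤ m := fun u =>
    le_csSup (isCompact_univ.image (hI.continuous.comp h.continuous)).bddAbove ⟨u, trivial, rfl⟩
  let s : ℕ → ℝ := fun n => 1 / ((n : ℝ) + 1)
  have hs : ∀ n, 0 < s n := fun n => by positivity
  have hs0 : Tendsto s atTop (𝓝 0) := tendsto_one_div_add_atTop_nhds_zero_nat
  have hex : ∀ n, ∃ u, m ≤ I (h u - s n • w u) + ε * s n := by
    intro n
    obtain ⟨u, -, hu⟩ := isCompact_univ.exists_sSup_image_eq (univ_nonempty (α := D))
      (hI.continuous.comp (h - s n • w).continuous).continuousOn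
    refine ⟨u, (hmin (s n) (hs n)).trans_eq ?_⟩
    simp only [Function.comp_def] at hu
    rw [hu]
    rfl
  choose v hv using hex
  obtain ⟨u, φ, hφ, hu⟩ := CompactSpace.tendsto_subseq v
  have hsφ : Tendsto (fun n => s (φ n)) atTop (𝓝 0) := hs0.comp hφ.tendsto_atTop
  have hh : Tendsto (fun n => h (v (φ n))) atTop (𝓝 (h u)) := (h.continuous.tendsto u).comp hu
  have hw : Tendsto (fun n => w (v (φ n))) atTop (𝓝 (w u)) := (w.continuous.tendsto u).comp hu
  have hg : Tendsto (fun n => h (v (φ n)) - s (φ n) • w (v (φ n))) atTop (𝓝 (h u)) := by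
    simpa using hh.sub (hsφ.smul hw)
  refine ⟨u, (hm u).antisymm ?_, ?_⟩
  · have h1 := ((hI.continuous.tendsto _).comp hg).add (hsφ.const_mul ε)
    simp only [mul_zero, add_zero] at h1
    exact ge_of_tendsto' h1 fun n => hv (φ n)
  · have hstrict : HasStrictFDerivAt I (fderiv ℝ I (h u)) (h u) :=
      hI.contDiffAt.hasStrictFDerivAt one_ne_zero
    have hbound : ∀ η : ℝ, 0 < η → fderiv ℝ I (h u) (w u) ≤ ε + η * ‖w u‖ := by
      intro η hη
      refine le_of_tendsto_of_tendsto (((fderiv ℝ I (h u)).continuous.tendsto _).comp hw)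
        (tendsto_const_nhds.add (hw.norm.const_mul η)) ?_
      filter_upwards [(hg.prodMk_nhds hh).eventually (hstrict.isLittleO.def hη)] with n hn
      have hpos := hs (φ n)
      simp only [sub_sub_cancel_left, map_neg, map_smul, norm_neg, norm_smul, smul_eq_mul,
        Real.norm_eq_abs, abs_of_pos hpos] at hn
      have h1 := (abs_le.1 hn).1
      have h2 := (abs_le.1 hn).2
      have h3 := hv (φ n)
      have h4 := hm (v (φ n))
      refine le_of_mul_le_mul_left ?_ hpos
      simp only [Function.comp_apply]
      linarith
    have hcont : Tendsto (fun η : ℝ => ε + η * ‖w u‖) (𝓝[>] 0) (𝓝 (ε + 0 * ‖w u‖)) :=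
      ((continuous_const.add (continuous_id.mul continuous_const)).tendsto 0).mono_left
        nhdsWithin_le_nhds
    simpa using ge_of_tendsto hcont (eventually_mem_nhdsWithin.mono fun η hη => hbound η hη)

/-- An even `C¹` functional has an odd continuous field of almost steepest ascent directions. -/
theorem exists_odd_almost_gradient {X : Type*} [NormedAddCommGroup X] [NormedSpace ℝ X]
    {I : X → ℝ} (hI : ContDiff ℝ 1 I) (heven : ∀ u, I (-u) = I u) {ε : ℝ} (hε : 0 < ε) :
    ∃ W : C(X, X), (∀ x, W (-x) = -W x) ∧ (∀ x, ‖W x‖ ≤ 1) ∧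
      ∀ x, ‖fderiv ℝ I x‖ - ε < fderiv ℝ I x (W x) := by
  have hfd : Continuous (fderiv ℝ I) := hI.continuous_fderiv one_ne_zero
  obtain ⟨V, hV⟩ := exists_continuous_forall_mem_convex_of_local_const
    (t := fun x => {v : X | ‖v‖ ≤ 1 ∧ ‖fderiv ℝ I x‖ - ε < fderiv ℝ I x v})
    (fun x => by
      refine Convex.inter (s := {v : X | ‖v‖ ≤ 1}) ?_ ?_
      · simpa [Metric.closedBall, dist_zero_right] using convex_closedBall (0 : X) 1
      · exact convex_halfSpace_gt (fderiv ℝ I x).toLinearMap.isLinear _)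
    (fun x => by
      obtain ⟨v, hv1, hv⟩ := (fderiv ℝ I x).exists_lt_apply_of_lt_opNorm (sub_lt_self _ hε)
      have key : ∃ v : X, ‖v‖ ≤ 1 ∧ ‖fderiv ℝ I x‖ - ε < fderiv ℝ I x v := by
        rcases abs_cases (fderiv ℝ I x v) with ⟨h, -⟩ | ⟨h, -⟩
        · exact ⟨v, hv1.le, by rwa [Real.norm_eq_abs, h] at hv⟩
        · exact ⟨-v, by simpa using hv1.le, by rwa [Real.norm_eq_abs, h, ← map_neg] at hv⟩
      obtain ⟨v, hv1, hv⟩ := key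
      refine ⟨v, ?_⟩
      filter_upwards [((hfd.norm.sub continuous_const).tendsto x).eventually_lt
        ((hfd.clm_apply continuous_const).tendsto x) hv] with y hy
      exact ⟨hv1, hy⟩)
  have hodd : ∀ x, fderiv ℝ I (-x) = -fderiv ℝ I x := fun x => by
    have h1 : HasFDerivAt I (fderiv ℝ I (-x) ∘SL (-ContinuousLinearMap.id ℝ X)) x := by
      have h2 := ((hI.differentiable one_ne_zero) (-x)).hasFDerivAt.comp x (hasFDerivAt_id x).neg
      exact h2.congr_of_eventuallyEq (Eventually.of_forall fun y => (heven y).symm)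
    rw [h1.fderiv]
    ext v
    simp
  refine ⟨⟨fun x => (2⁻¹ : ℝ) • (V x - V (-x)), by fun_prop⟩, fun x => ?_, fun x => ?_,
    fun x => ?_⟩
  · simp [← smul_neg]
  · have h1 := norm_sub_le (V x) (V (-x))
    have h2 := (hV x).1
    have h3 := (hV (-x)).1
    simp only [ContinuousMap.coe_mk, norm_smul, norm_inv, Real.norm_ofNat]
    linarith
  · have h2 := (hV x).2
    have h3 := (hV (-x)).2
    rw [hodd, norm_neg, neg_apply] at h3
    simp only [ContinuousMap.coe_mk, map_smul, map_sub, smul_eq_mul]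
    linarith

/-- Almost critical points exist at the level `minimax I Yk Rk`. -/
theorem exists_almost_critical_of_minimax_pos {X : Type*} [NormedAddCommGroup X]
    [NormedSpace ℝ X] [CompleteSpace X] {I : X → ℝ} (hI : ContDiff ℝ 1 I)
    (heven : ∀ u : X, I (-u) = I u) {Yk : Submodule ℝ X} [FiniteDimensional ℝ Yk] {Rk : ℝ}
    (hRk : 0 < Rk) (hneg : ∀ u ∈ Yk, ‖u‖ = Rk → I u < 0)
    (hpos : 0 < minimax I Yk Rk) {ε : ℝ} (hε : 0 < ε) :
    ∃ x, minimax I Yk Rk ≤ I x ∧ I x ≤ minimax I Yk Rk + ε ∧ ‖fderiv ℝ I x‖ ≤ 2 * ε := by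
  set c := minimax I Yk Rk
  let D : Set X := {u : X | u ∈ Yk ∧ ‖u‖ ≤ Rk}
  have hDneg : ∀ u ∈ D, -u ∈ D := fun u hu => ⟨Yk.neg_mem hu.1, by simpa using hu.2⟩
  have hDc : IsCompact D := by
    have := FiniteDimensional.proper ℝ Yk
    have himage : D = (Subtype.val : Yk → X) '' Metric.closedBall 0 Rk := by
      ext u
      simp [D, and_comm]
    rw [himage]
    exact (isCompact_closedBall _ _).image continuous_subtype_val
  have : CompactSpace D := isCompact_iff_compactSpace.1 hDc
  have : Nonempty D := ⟨⟨0, Yk.zero_mem, by simpa using hRk.le⟩⟩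
  let G : Set C(D, X) := {h | (∀ u : D, h ⟨-u, hDneg u u.2⟩ = -h u) ∧
    ∀ u : D, ‖(u : X)‖ = Rk → h u = u}
  have hGclosed : IsClosed G := by
    simp only [G, ofPred_and, ofPred_forall]
    refine (isClosed_iInter fun u => isClosed_eq (by fun_prop) (by fun_prop)).inter
      (isClosed_iInter fun u => isClosed_iInter fun _ => isClosed_eq (by fun_prop) (by fun_prop))
  have : CompleteSpace G := hGclosed.completeSpace_coe
  let Φ : C(D, X) → ℝ := fun h => sSup ((fun u => I (h u)) '' univ)
  have hΦ : Continuous Φ := by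
    refine isCompact_univ.continuous_sSup (f := fun (h : C(D, X)) u => I (h u)) ?_
    exact hI.continuous.comp (by fun_prop : Continuous fun p : C(D, X) × D => p.1 p.2)
  set S : Set ℝ := {r : ℝ | ∃ h : X → X,
    ContinuousOn h {u : X | u ∈ Yk ∧ ‖u‖ ≤ Rk} ∧
    (∀ u : X, u ∈ Yk → ‖u‖ ≤ Rk → h (-u) = -h u) ∧
    (∀ u : X, u ∈ Yk → ‖u‖ = Rk → h u = u) ∧
    r = sSup ((fun u => I (h u)) '' {u : X | u ∈ Yk ∧ ‖u‖ ≤ Rk})}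
  have hcS : c = sInf S := rfl
  have hSbdd : BddBelow S := by
    by_contra hn
    rw [hcS, Real.sInf_of_not_bddBelow hn] at hpos
    exact hpos.false
  have hSne : S.Nonempty := by
    rw [nonempty_iff_ne_empty]
    intro hn
    rw [hcS, hn, Real.sInf_empty] at hpos
    exact hpos.false
  have hGS : ∀ g ∈ G, Φ g ∈ S := by
    rintro g ⟨hodd, hbd⟩
    have hext : ∀ u : D, Function.extend Subtype.val g 0 (u : X) = g u :=
      fun u => Subtype.val_injective.extend_apply g 0 u
    refine ⟨Function.extend Subtype.val g 0, ?_, fun u hu hu' => ?_, fun u hu hu' => ?_, ?_⟩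
    · rw [continuousOn_iff_continuous_domRestrict]
      convert g.continuous using 1
      ext u
      exact hext u
    · have h1 := hodd ⟨u, hu, hu'⟩
      rw [← hext, ← hext] at h1
      exact h1
    · have h1 := hbd ⟨u, hu, hu'.le⟩ hu'
      rwa [← hext] at h1
    · refine congrArg sSup (Set.ext fun r => ?_)
      constructor
      · rintro ⟨u, -, rfl⟩
        exact ⟨u, u.2, by simp only [hext]⟩
      · rintro ⟨u, hu, rfl⟩
        exact ⟨⟨u, hu⟩, trivial, by simp only [← hext]⟩
  have hcle : ∀ g ∈ G, c ≤ Φ g := fun g hg => csInf_le hSbdd (hGS g hg)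
  obtain ⟨r, ⟨h₀, hcont, hodd₀, hbd₀, rfl⟩, hlt⟩ :=
    exists_lt_of_csInf_lt hSne (lt_add_of_pos_right (sInf S) hε)
  let g₀ : G := ⟨⟨D.domRestrict h₀, continuousOn_iff_continuous_domRestrict.1 hcont⟩,
    fun u => hodd₀ u u.2.1 u.2.2, fun u hu => hbd₀ u u.2.1 hu⟩
  have hg₀ : Φ g₀ ≤ c + ε := by
    refine le_of_eq_of_le ?_ hlt.le
    refine congrArg sSup (Set.ext fun r => ?_)
    constructor
    · rintro ⟨u, -, rfl⟩
      exact ⟨u, u.2, rfl⟩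
    · rintro ⟨u, hu, rfl⟩
      exact ⟨⟨u, hu⟩, trivial, rfl⟩
  obtain ⟨⟨h, hG⟩, hle, hmin⟩ := exists_le_forall_le_add_mul_dist
    (f := fun g : G => Φ g) (hΦ.comp continuous_subtype_val)
    ⟨c, by rintro _ ⟨g, rfl⟩; exact hcle g g.2⟩ hε g₀
  obtain ⟨W, hWodd, hW1, hW⟩ := exists_odd_almost_gradient hI heven hε
  -- the cutoff vanishes on `{I ≤ 0}` and equals one on `{I ≥ c}`
  let χ : C(X, ℝ) := ⟨fun x => max 0 (min 1 (I x / c)), by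
    have := hI.continuous
    fun_prop⟩
  have hχ1 : ∀ x, |χ x| ≤ 1 := fun x => by
    rw [abs_of_nonneg (le_max_left _ _)]
    exact max_le zero_le_one (min_le_left _ _)
  let w : C(D, X) := ⟨fun u => χ (h u) • W (h u), by fun_prop⟩
  have hw1 : ‖w‖ ≤ 1 := by
    rw [ContinuousMap.norm_le _ zero_le_one]
    intro u
    change ‖χ (h u) • W (h u)‖ ≤ 1
    rw [norm_smul]
    exact mul_le_one₀ (hχ1 _) (norm_nonneg _) (hW1 _)
  have hwG : ∀ s : ℝ, h - s • w ∈ G := by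
    refine fun s => ⟨fun u => ?_, fun u hu => ?_⟩
    · have hχe : χ (-h u) = χ (h u) := by simp [χ, heven]
      simp only [ContinuousMap.sub_apply, ContinuousMap.smul_apply, w, ContinuousMap.coe_mk,
        hG.1 u, hWodd, hχe, smul_neg]
      abel
    · have hχ0 : χ u = 0 := by
        have h1 : I u / c ≤ 0 := (div_neg_of_neg_of_pos (hneg u u.2.1 hu) hpos).le
        exact max_eq_left ((min_le_right _ _).trans h1)
      simp [w, hG.2 u hu, hχ0]
  obtain ⟨u, hu, hder⟩ := exists_isMax_fderiv_apply_le hI h w (ε := ε) (fun s hs => by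
    refine (hmin ⟨h - s • w, hwG s⟩).trans ?_
    have hd : dist (⟨h, hG⟩ : G) ⟨h - s • w, hwG s⟩ ≤ s := by
      rw [Subtype.dist_eq, dist_eq_norm, sub_sub_cancel, norm_smul, Real.norm_eq_abs,
        abs_of_pos hs]
      exact mul_le_of_le_one_right hs.le hw1
    have := mul_le_mul_of_nonneg_left hd hε.le
    change Φ (h - s • w) + _ ≤ Φ (h - s • w) + _
    linarith)
  have hcu : c ≤ I (h u) := (hcle h hG).trans_eq hu.symm
  refine ⟨h u, hcu, hu.trans_le (hle.trans hg₀), ?_⟩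
  have hχu : χ (h u) = 1 := by
    have h1 : 1 ≤ I (h u) / c := (one_le_div hpos).2 hcu
    simp [χ, h1]
  have hwu : w u = W (h u) := by simp [w, hχu]
  have := hW (h u)
  rw [hwu] at hder
  linarith

/-- If `I ∈ C¹(X, ℝ)` is even, satisfies (PS), `Y^k` is a `k`-dimensional subspace,
`I < 0` on `{u ∈ Y^k : ‖u‖ ≥ R_k}`, and the minimax value `c_k` is positive,
then `c_k` is a critical value of `I`. -/
theorem minimax_is_critical_value {X : Type*} [NormedAddCommGroup X] [NormedSpace ℝ X]
    [CompleteSpace X] (I : X → ℝ) (hC1 : ContDiff ℝ 1 I)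
    (heven : ∀ u : X, I (-u) = I u) (hPS : PalaisSmale I)
    (k : ℕ) (Yk : Subspace ℝ X) [FiniteDimensional ℝ Yk] (hdim : Module.finrank ℝ Yk = k)
    (Rk : ℝ) (hRk : 0 < Rk)
    (hneg : ∀ u : X, u ∈ Yk → Rk ≤ ‖u‖ → I u < 0)
    (hpos : 0 < minimax I Yk Rk) :
    ∃ v : X, fderiv ℝ I v = 0 ∧ I v = minimax I Yk Rk := by
  have hs : ∀ n : ℕ, (0 : ℝ) < 1 / ((n : ℝ) + 1) := fun n => by positivity
  have hs0 : Tendsto (fun n : ℕ => 1 / ((n : ℝ) + 1)) atTop (𝓝 0) :=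
    tendsto_one_div_add_atTop_nhds_zero_nat
  choose x hx1 hx2 hx3 using fun n => exists_almost_critical_of_minimax_pos hC1 heven hRk
    (fun u hu hu' => hneg u hu hu'.ge) hpos (hs n)
  have hI : Tendsto (fun n => I (x n)) atTop (𝓝 (minimax I Yk Rk)) :=
    tendsto_of_tendsto_of_tendsto_of_le_of_le tendsto_const_nhds
      (by simpa using hs0.const_add (minimax I Yk Rk)) hx1 hx2
  have hd : Tendsto (fun n => ‖fderiv ℝ I (x n)‖) atTop (𝓝 0) :=
    squeeze_zero (fun _ => norm_nonneg _) hx3 (by simpa using hs0.const_mul 2)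
  obtain ⟨C, hC⟩ := (Metric.isBounded_range_of_tendsto _ hI).exists_norm_le
  obtain ⟨v, φ, hφ, hv⟩ := hPS x ⟨C, fun n => hC _ ⟨n, rfl⟩⟩ hd
  refine ⟨v, ?_, ?_⟩
  · rw [← norm_eq_zero]
    exact tendsto_nhds_unique
      (((hC1.continuous_fderiv one_ne_zero).norm.tendsto v).comp hv)
      (hd.comp hφ.tendsto_atTop)
  · exact tendsto_nhds_unique ((hC1.continuous.tendsto v).comp hv) (hI.comp hφ.tendsto_atTop)
end
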